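/- arXiv:math/0010140 — 5 statements merged into one kernel-verified Lean document; each statement's English description precedes it below -/
import Mathlib

section
/- (Cyclic sum theorem, form (1).) Let l ≥ 1 and let k₁,…,k_l be positive integers with k_i ≥ 2 for at least one i. Then ∑_{j=1}^{l} ζ(k_j+1, k_{j+1},…,k_l, k₁,…,k_{j−1}) = ∑_{j : k_j ≥ 2} ∑_{q=0}^{k_j−2} ζ(k_j−q, k_{j+1},…,k_l, k₁,…,k_{j−1}, q+1), where indices are read cyclically (the j-th term on the left is ζ applied to the cyclic shift of (k₁,…,k_l) starting at position j, with its first entry increased by 1). -/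
/-- The multiple zeta value `ζ(k₁,…,k_l) = ∑_{n₁>n₂>⋯>n_l≥1} 1/(n₁^{k₁} ⋯ n_l^{k_l})`,
encoded as a `tsum` over tuples `n : Fin l → ℕ` that are strictly decreasing and positive. -/
noncomputable def mzv (k : List ℕ) : ℝ :=
  ∑' n : Fin k.length → ℕ,
    if (∀ i j : Fin k.length, i < j → n j < n i) ∧ (∀ i, 1 ≤ n i) then
      ∏ i : Fin k.length, ((n i : ℝ) ^ k.get i)⁻¹
    else 0

namespace CSum
open scoped ENNReal
open Finset

noncomputable def w (n a : ℕ) : ℝ≥0∞ := if n = 0 then 0 else ENNReal.ofReal (((n : ℝ) ^ a)⁻¹)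

noncomputable def d (n m : ℕ) : ℝ≥0∞ := ENNReal.ofReal (((n : ℝ) - m)⁻¹)

noncomputable def W : List ℕ → ℕ → (ℕ → ℝ≥0∞) → ℝ≥0∞
  | [], N, g => g N
  | a :: k, N, g => ∑ n ∈ range N, w n a * W k n g

noncomputable def Z (a : ℕ) (k : List ℕ) : ℝ≥0∞ := ∑' n, w n a * W k n (fun _ => 1)

noncomputable def T (a : ℕ) (k : List ℕ) : ℝ≥0∞ :=
  ∑' n, w n a * W k n (fun r => ∑ m ∈ range r, d n m)

noncomputable def S (a : ℕ) (k : List ℕ) (q : ℕ) : ℝ≥0∞ :=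
  ∑' n, w n a * W k n (fun r => ∑ m ∈ range r, w m q * d n m)

lemma w_zero (a : ℕ) : w 0 a = 0 := by simp [w]

lemma W_mono (k : List ℕ) : ∀ (N : ℕ) (g g' : ℕ → ℝ≥0∞), N ≠ 0 →
    (∀ r, r ≠ 0 → r ≤ N → g r ≤ g' r) → W k N g ≤ W k N g' := by
  induction k with
  | nil => intro N g g' hN h; exact h N hN le_rfl
  | cons a k ih =>
    intro N g g' hN h
    simp only [W]
    refine Finset.sum_le_sum fun n hn => ?_
    rcases eq_or_ne n 0 with rfl | h0
    · simp [w_zero]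
    · have := mem_range.1 hn
      gcongr
      exact ih n g g' h0 fun r hr hrn => h r hr (by omega)

lemma W_congr (k : List ℕ) (N : ℕ) (g g' : ℕ → ℝ≥0∞) (hN : N ≠ 0)
    (h : ∀ r, r ≠ 0 → r ≤ N → g r = g' r) : W k N g = W k N g' :=
  le_antisymm (W_mono k N g g' hN fun r a b => (h r a b).le)
    (W_mono k N g' g hN fun r a b => (h r a b).ge)

lemma W_add (k : List ℕ) : ∀ (N : ℕ) (g g' : ℕ → ℝ≥0∞),
    W k N (fun r => g r + g' r) = W k N g + W k N g' := by
  induction k with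
  | nil => intro N g g'; rfl
  | cons a k ih =>
    intro N g g'
    simp only [W, ih, mul_add, Finset.sum_add_distrib]

lemma W_mul (k : List ℕ) (c : ℝ≥0∞) : ∀ (N : ℕ) (g : ℕ → ℝ≥0∞),
    W k N (fun r => c * g r) = c * W k N g := by
  induction k with
  | nil => intro N g; rfl
  | cons a k ih =>
    intro N g
    simp only [W, ih, Finset.mul_sum, mul_left_comm]

lemma W_tsum (k : List ℕ) : ∀ (N : ℕ) (g : ℕ → ℕ → ℝ≥0∞),
    W k N (fun r => ∑' i, g i r) = ∑' i, W k N (g i) := by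
  induction k with
  | nil => intro N g; rfl
  | cons a k ih =>
    intro N g
    simp only [W, ih, ← ENNReal.tsum_mul_left]
    rw [Summable.tsum_finsetSum (fun _ _ => ENNReal.summable)]

lemma W_append (k : List ℕ) (q : ℕ) : ∀ (N : ℕ) (g : ℕ → ℝ≥0∞),
    W (k ++ [q]) N g = W k N (fun r => ∑ m ∈ range r, w m q * g m) := by
  induction k with
  | nil => intro N g; rfl
  | cons a k ih => intro N g; simp only [W, List.cons_append, ih]

lemma w_d_zero (n a : ℕ) : w n a * d n 0 = w n (a + 1) := by
  unfold w d
  split_ifs with h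
  · simp
  · rw [← ENNReal.ofReal_mul (by positivity)]
    congr 1
    simp [pow_succ, mul_comm]

lemma T_eq (a : ℕ) (k : List ℕ) : T a k = Z (a + 1) k + S a k 0 := by
  unfold T Z S
  rw [← ENNReal.tsum_add]
  refine tsum_congr fun n => ?_
  rcases eq_or_ne n 0 with rfl | h0
  · simp [w_zero]
  rw [← w_d_zero, mul_assoc, ← W_mul k (d n 0), ← mul_add, ← W_add]
  congr 1
  refine W_congr _ _ _ _ h0 fun r hr _ => ?_
  obtain ⟨r, rfl⟩ := Nat.exists_eq_succ_of_ne_zero hr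
  simp only [Nat.succ_eq_add_one]
  rw [Finset.sum_range_succ', Finset.sum_range_succ']
  simp [w, add_comm]

lemma frac (n m a q : ℕ) (hm : m < n) :
    w n (a + 1) * (w m q * d n m) + w n (a + 1) * w m (q + 1) = w n a * (w m (q + 1) * d n m) := by
  unfold w d
  have hn : n ≠ 0 := by omega
  rcases eq_or_ne m 0 with rfl | h0
  · simp
  rw [if_neg hn, if_neg hn, if_neg h0, if_neg h0]
  have hnr : (0 : ℝ) < n := by positivity
  have hmr : (0 : ℝ) < m := by positivity
  have hd : (0 : ℝ) < (n : ℝ) - m := by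
    have : (m : ℝ) < n := by exact_mod_cast hm
    linarith
  rw [← ENNReal.ofReal_mul (by positivity), ← ENNReal.ofReal_mul (by positivity),
    ← ENNReal.ofReal_mul (by positivity), ← ENNReal.ofReal_mul (by positivity),
    ← ENNReal.ofReal_mul (by positivity), ← ENNReal.ofReal_add (by positivity) (by positivity)]
  congr 1
  field_simp
  ring

lemma S_step (a : ℕ) (k : List ℕ) (q : ℕ) :
    S (a + 1) k q + Z (a + 1) (k ++ [q + 1]) = S a k (q + 1) := by
  unfold S Z
  rw [← ENNReal.tsum_add]
  refine tsum_congr fun n => ?_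
  rcases eq_or_ne n 0 with rfl | h0
  · simp [w_zero]
  rw [W_append, ← W_mul, ← W_mul, ← W_mul, ← W_add]
  refine W_congr _ _ _ _ h0 fun r hr hrn => ?_
  rw [Finset.mul_sum, Finset.mul_sum, Finset.mul_sum, ← Finset.sum_add_distrib]
  refine Finset.sum_congr rfl fun m hm => ?_
  have := mem_range.1 hm
  rw [mul_one, frac n m a q (by omega)]

lemma S_iter (p : ℕ) (k : List ℕ) : ∀ q, S (p + 1) k q +
    ∑ i ∈ range p, Z (p + 1 - i) (k ++ [q + i + 1]) = S 1 k (q + p) := by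
  induction p with
  | zero => intro q; simp
  | succ p ih =>
    intro q
    rw [Finset.sum_range_succ', add_comm (Finset.sum _ _), ← add_assoc]
    simp only [Nat.sub_zero, add_zero]
    rw [S_step, show q + (p + 1) = (q + 1) + p by ring, ← ih (q + 1)]
    congr 1
    refine Finset.sum_congr rfl fun i _ => ?_
    rw [show p + 1 + 1 - (i + 1) = p + 1 - i by omega,
      show q + (i + 1) + 1 = q + 1 + i + 1 by omega]

lemma tel (c : ℕ) (hc : c ≠ 0) :
    ∑' i : ℕ, ENNReal.ofReal (((c + i : ℕ) : ℝ)⁻¹ - ((c + i + 1 : ℕ) : ℝ)⁻¹)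
      = ENNReal.ofReal ((c : ℝ)⁻¹) := by
  have hnn : ∀ i : ℕ, 0 ≤ ((c + i : ℕ) : ℝ)⁻¹ - ((c + i + 1 : ℕ) : ℝ)⁻¹ := by
    intro i
    rw [sub_nonneg]
    apply inv_anti₀
    · have : 0 < c + i := by omega
      exact_mod_cast this
    · exact_mod_cast Nat.le_succ _
  have hs : HasSum (fun i : ℕ => ((c + i : ℕ) : ℝ)⁻¹ - ((c + i + 1 : ℕ) : ℝ)⁻¹) ((c : ℝ)⁻¹) := by
    rw [hasSum_iff_tendsto_nat_of_nonneg hnn]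
    have h : ∀ n : ℕ, ∑ i ∈ range n, (((c + i : ℕ) : ℝ)⁻¹ - ((c + i + 1 : ℕ) : ℝ)⁻¹)
        = (c : ℝ)⁻¹ - ((n + c : ℕ) : ℝ)⁻¹ := by
      intro n
      have := Finset.sum_range_sub' (fun i : ℕ => ((c + i : ℕ) : ℝ)⁻¹) n
      simp only [add_zero] at this
      rw [add_comm n c, ← this]
      rfl
    simp only [h]
    have : Filter.Tendsto (fun n : ℕ => ((n + c : ℕ) : ℝ)⁻¹) Filter.atTop (nhds 0) :=
      (tendsto_inv_atTop_nhds_zero_nat (𝕜 := ℝ)).comp (Filter.tendsto_add_atTop_nat c)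
    simpa using this.const_sub ((c : ℝ)⁻¹)
  rw [← ENNReal.ofReal_tsum_of_nonneg hnn hs.summable, hs.tsum_eq]

lemma tel_m (N m : ℕ) (hm : m ≤ N) :
    ∑' i : ℕ, ENNReal.ofReal (((N + 1 + i : ℕ) - m : ℝ)⁻¹ - ((N + 1 + i : ℕ) : ℝ)⁻¹)
      = ∑ j ∈ range m, d N j := by
  induction m with
  | zero => simp
  | succ m ih =>
    rw [Finset.sum_range_succ, ← ih (by omega)]
    have := tel (N - m) (by omega)
    rw [d, ← Nat.cast_sub (by omega), ← this, ← ENNReal.tsum_add]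
    refine tsum_congr fun i => ?_
    have e1 : ((N - m + i : ℕ) : ℝ) = (N + 1 + i : ℕ) - (m + 1 : ℕ) := by
      push_cast [Nat.cast_sub (show m ≤ N by omega)]; ring
    have e2 : ((N - m + i + 1 : ℕ) : ℝ) = (N + 1 + i : ℕ) - m := by
      push_cast [Nat.cast_sub (show m ≤ N by omega)]; ring
    have hmN : (m : ℝ) + 1 ≤ N := by exact_mod_cast hm
    have hi : (0 : ℝ) ≤ i := by positivity
    have hm0 : (0 : ℝ) ≤ m := by positivity
    rw [← ENNReal.ofReal_add, e1, e2]
    · congr 1; ring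
    · rw [sub_nonneg]
      apply inv_anti₀ <;> push_cast <;> linarith
    · rw [e1, e2, sub_nonneg]
      apply inv_anti₀ <;> push_cast <;> linarith

lemma tail_sum (N m a : ℕ) (hm : m ≤ N) :
    ∑' n : ℕ, (if N < n then w n 1 * (w m a * d n m) else 0)
      = w m (a + 1) * ∑ j ∈ range m, d N j := by
  rcases eq_or_ne m 0 with rfl | h0
  · simp [w_zero]
  rw [← tel_m N m hm, ← ENNReal.tsum_mul_left]
  rw [← Summable.sum_add_tsum_nat_add' (k := N + 1) ENNReal.summable, Finset.sum_eq_zero, zero_add]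
  · refine tsum_congr fun i => ?_
    rw [if_pos (by omega), add_comm i (N + 1)]
    generalize hn : N + 1 + i = n
    have hmn : m < n := by omega
    have hd : (0 : ℝ) < (n : ℝ) - m := by
      have : (m : ℝ) < n := by exact_mod_cast hmn
      linarith
    have hmr : (0 : ℝ) < m := by positivity
    have hnr : (0 : ℝ) < n := by linarith
    unfold w d
    rw [if_neg (by omega), if_neg h0, if_neg h0]
    rw [← ENNReal.ofReal_mul (by positivity), ← ENNReal.ofReal_mul (by positivity),
      ← ENNReal.ofReal_mul (by positivity)]
    congr 1
    field_simp
    ring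
  · intro n hn
    have := mem_range.1 hn
    rw [if_neg (by omega)]

lemma swap (f : ℕ → ℕ → ℝ≥0∞) :
    ∑' n, ∑ m ∈ range n, f n m = ∑' m, ∑' n, (if m < n then f n m else 0) := by
  rw [ENNReal.tsum_comm]
  refine tsum_congr fun n => ?_
  rw [tsum_eq_sum (s := range n)]
  · refine Finset.sum_congr rfl fun m hm => ?_
    rw [if_pos (mem_range.1 hm)]
  · intro m hm
    rw [if_neg (by simpa using hm)]

lemma S_one_nil (a : ℕ) : S 1 [] a = T (a + 1) [] := by
  unfold S T
  simp only [W, Finset.mul_sum]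
  rw [swap]
  refine tsum_congr fun m => ?_
  rw [tail_sum m m a le_rfl, Finset.mul_sum]

lemma S_one_cons (b : ℕ) (k : List ℕ) (a : ℕ) : S 1 (b :: k) a = T b (k ++ [a + 1]) := by
  unfold S T
  simp only [W, Finset.mul_sum]
  rw [swap]
  refine tsum_congr fun N => ?_
  rcases eq_or_ne N 0 with rfl | h0
  · simp [w_zero]
  rw [W_append]
  have h1 : ∀ n, (if N < n then w n 1 * (w N b * W k N (fun r => ∑ m ∈ range r, w m a * d n m))
      else 0) = w N b * W k N (fun r => if N < n then
        w n 1 * ∑ m ∈ range r, w m a * d n m else 0) := by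
    intro n
    split_ifs
    · rw [W_mul]; ring
    · have := W_mul k 0 N (fun _ => 0)
      simp only [zero_mul] at this
      rw [this, mul_zero]
  simp only [h1]
  rw [ENNReal.tsum_mul_left, ← W_tsum]
  congr 1
  refine W_congr _ _ _ _ h0 fun r hr hrN => ?_
  have h2 : ∀ n, (if N < n then w n 1 * ∑ m ∈ range r, w m a * d n m else 0)
      = ∑ m ∈ range r, if N < n then w n 1 * (w m a * d n m) else 0 := by
    intro n
    split_ifs
    · rw [Finset.mul_sum]
    · simp
  simp only [h2]
  rw [Summable.tsum_finsetSum (fun _ _ => ENNReal.summable)]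
  refine Finset.sum_congr rfl fun m hm => ?_
  have := mem_range.1 hm
  rw [tail_sum N m a (by omega)]

noncomputable def TL : List ℕ → ℝ≥0∞
  | [] => 0
  | a :: k => T a k

lemma S_one (k : List ℕ) (a : ℕ) : S 1 k a = TL (k ++ [a + 1]) := by
  cases k with
  | nil => exact S_one_nil a
  | cons b k => exact S_one_cons b k a

lemma main_rel (a : ℕ) (ha : 1 ≤ a) (k : List ℕ) :
    TL (a :: k) + ∑ q ∈ range (a - 1), Z (a - q) (k ++ [q + 1])
      = Z (a + 1) k + TL (k ++ [a]) := by
  obtain ⟨p, rfl⟩ := Nat.exists_eq_add_of_le' ha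
  have := S_iter p k 0
  simp only [zero_add] at this
  rw [← S_one, ← this]
  simp only [TL, T_eq, Nat.add_sub_cancel, add_assoc]

/-! finiteness -/

noncomputable def H (n : ℕ) : ℝ≥0∞ := ∑ i ∈ range n, ENNReal.ofReal (((i + 1 : ℕ) : ℝ)⁻¹)

lemma H_mono {m n : ℕ} (h : m ≤ n) : H m ≤ H n :=
  Finset.sum_le_sum_of_subset (by simpa using h)

lemma w_anti (n a b : ℕ) (h : a ≤ b) : w n b ≤ w n a := by
  unfold w
  split_ifs with h0
  · rfl
  · apply ENNReal.ofReal_le_ofReal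
    have : (1 : ℝ) ≤ n := by exact_mod_cast Nat.one_le_iff_ne_zero.2 h0
    apply inv_anti₀ (by positivity)
    exact pow_le_pow_right₀ this h

lemma sum_w_le (n a : ℕ) (ha : 1 ≤ a) : ∑ i ∈ range n, w i a ≤ H n := by
  cases n with
  | zero => simp
  | succ n =>
    rw [Finset.sum_range_succ', w_zero, add_zero]
    refine le_trans ?_ (H_mono (Nat.le_succ n))
    refine Finset.sum_le_sum fun i _ => (w_anti _ _ _ ha).trans ?_
    simp [w]

lemma W_le (k : List ℕ) (hk : ∀ a ∈ k, 1 ≤ a) (C : ℝ≥0∞) (g : ℕ → ℝ≥0∞) : ∀ N : ℕ,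
    (∀ r, r ≤ N → g r ≤ C) → W k N g ≤ H N ^ k.length * C := by
  induction k with
  | nil => intro N h; simpa [W] using h N le_rfl
  | cons a k ih =>
    intro N h
    simp only [W, List.length_cons]
    calc ∑ n ∈ range N, w n a * W k n g
        ≤ ∑ n ∈ range N, w n a * (H N ^ k.length * C) := by
          refine Finset.sum_le_sum fun n hn => ?_
          have hn := mem_range.1 hn
          gcongr
          refine (ih (fun a ha => hk a (List.mem_cons_of_mem _ ha)) n
            fun r hr => h r (by omega)).trans ?_
          have := H_mono hn.le
          gcongr
      _ = (∑ n ∈ range N, w n a) * (H N ^ k.length * C) := by rw [Finset.sum_mul]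
      _ ≤ H N * (H N ^ k.length * C) := by
          gcongr
          exact sum_w_le N a (hk a (by simp))
      _ = _ := by ring

lemma sum_d (n : ℕ) : ∑ m ∈ range n, d n m = H n := by
  unfold H
  rw [← Finset.sum_range_reflect]
  refine Finset.sum_congr rfl fun i hi => ?_
  have := mem_range.1 hi
  unfold d
  rw [← Nat.cast_sub (by omega)]
  congr 3
  omega

lemma H_eq (n : ℕ) : H n = ENNReal.ofReal (harmonic n : ℝ) := by
  unfold H harmonic
  rw [← ENNReal.ofReal_sum_of_nonneg (fun _ _ => by positivity)]
  simp

lemma fin_sum (p : ℕ) : ∑' n, w n 2 * H n ^ p ≠ ⊤ := by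
  have hs : Summable (fun n : ℕ => ((n : ℝ) ^ 2)⁻¹ * (harmonic n : ℝ) ^ p) := by
    have hsum : Summable (fun n : ℕ => (n : ℝ) ^ (-(3 / 2) : ℝ)) :=
      Real.summable_nat_rpow.2 (by norm_num)
    refine summable_of_isBigO_nat hsum ?_
    have h1 : (fun n : ℕ => (harmonic n : ℝ) ^ p) =O[Filter.atTop]
        (fun n : ℕ => (n : ℝ) ^ (1 / 2 : ℝ)) := by
      have h2 : (fun n : ℕ => (harmonic n : ℝ)) =O[Filter.atTop]
          (fun n : ℕ => Real.log n) := by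
        refine Asymptotics.IsBigO.of_bound 2 ?_
        filter_upwards [Filter.eventually_ge_atTop 3] with n hn
        have hlog : 1 ≤ Real.log n := by
          rw [Real.le_log_iff_exp_le (by positivity)]
          have : (3 : ℝ) ≤ n := by exact_mod_cast hn
          linarith [Real.exp_one_lt_three]
        have hh := harmonic_le_one_add_log n
        have hp : (0 : ℝ) ≤ (harmonic n : ℝ) := by
          have : (0 : ℚ) ≤ harmonic n := by
            unfold harmonic; positivity
          exact_mod_cast this
        rw [Real.norm_of_nonneg hp, Real.norm_of_nonneg (by linarith)]
        linarith
      refine (h2.pow p).trans ?_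
      have h3 := (isLittleO_log_rpow_rpow_atTop (s := (1/2 : ℝ)) (p : ℝ) (by norm_num)).isBigO
      have h4 := h3.comp_tendsto tendsto_natCast_atTop_atTop
      refine Asymptotics.IsBigO.congr' h4 ?_ ?_
      · exact Filter.Eventually.of_forall fun n => by simp
      · exact Filter.Eventually.of_forall fun n => by simp
    have h5 := (Asymptotics.isBigO_refl (fun n : ℕ => ((n : ℝ) ^ 2)⁻¹) Filter.atTop).mul h1
    refine h5.congr' Filter.EventuallyEq.rfl ?_
    filter_upwards [Filter.eventually_gt_atTop 0] with n hn
    have hn : (0 : ℝ) < n := by exact_mod_cast hn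
    rw [← Real.rpow_natCast, ← Real.rpow_neg hn.le, ← Real.rpow_add hn]
    norm_num
  refine ne_top_of_le_ne_top hs.tsum_ofReal_ne_top (ENNReal.tsum_le_tsum fun n => ?_)
  have hp : (0 : ℝ) ≤ (harmonic n : ℝ) := by
    have : (0 : ℚ) ≤ harmonic n := by
      unfold harmonic; positivity
    exact_mod_cast this
  rw [H_eq, ENNReal.ofReal_mul (by positivity), ENNReal.ofReal_pow hp]
  gcongr
  unfold w
  split_ifs
  · simp
  · rfl

lemma T_fin (a : ℕ) (ha : 2 ≤ a) (k : List ℕ) (hk : ∀ a ∈ k, 1 ≤ a) : T a k ≠ ⊤ := by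
  refine ne_top_of_le_ne_top (fin_sum (k.length + 1)) (ENNReal.tsum_le_tsum fun n => ?_)
  rw [pow_succ]
  gcongr
  · exact w_anti _ _ _ ha
  · refine W_le k hk _ _ n fun r hr => ?_
    rw [← sum_d]
    exact Finset.sum_le_sum_of_subset (by simpa using hr)

lemma Z_fin (a : ℕ) (ha : 2 ≤ a) (k : List ℕ) (hk : ∀ a ∈ k, 1 ≤ a) : Z a k ≠ ⊤ := by
  refine ne_top_of_le_ne_top (fin_sum k.length) (ENNReal.tsum_le_tsum fun n => ?_)
  gcongr
  · exact w_anti _ _ _ ha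
  · simpa using W_le k hk 1 (fun _ => 1) n fun r hr => le_rfl

/-! conversion -/

noncomputable def mzvTerm (k : List ℕ) (n : Fin k.length → ℕ) : ℝ≥0∞ :=
  if (∀ i j : Fin k.length, i < j → n j < n i) ∧ (∀ i, 1 ≤ n i) then
      ∏ i : Fin k.length, ENNReal.ofReal (((n i : ℝ) ^ k.get i)⁻¹)
    else 0

lemma term_cons (a : ℕ) (k : List ℕ) (m : ℕ) (n : Fin k.length → ℕ) :
    mzvTerm (a :: k) (Fin.cons m n : Fin (k.length + 1) → ℕ)
      = w m a * if ∀ i, n i < m then mzvTerm k n else 0 := by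
  have hiff : ((∀ i j : Fin (k.length + 1), i < j → (Fin.cons m n : Fin (k.length + 1) → ℕ) j
      < (Fin.cons m n : Fin (k.length + 1) → ℕ) i)
      ∧ (∀ i, 1 ≤ (Fin.cons m n : Fin (k.length + 1) → ℕ) i)) ↔
      (m ≠ 0 ∧ (∀ i, n i < m) ∧ (∀ i j : Fin k.length, i < j → n j < n i) ∧ (∀ i, 1 ≤ n i)) := by
    simp only [Fin.forall_fin_succ, Fin.cons_zero, Fin.cons_succ, Fin.succ_pos,
      Fin.succ_lt_succ_iff, Fin.not_lt_zero, Nat.one_le_iff_ne_zero, true_imp_iff, false_imp_iff, true_and]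
    tauto
  have hprod : ∏ i : Fin (k.length + 1), ENNReal.ofReal
      (((((Fin.cons m n : Fin (k.length + 1) → ℕ) i : ℕ) : ℝ) ^ (a :: k).get i)⁻¹)
      = ENNReal.ofReal (((m : ℝ) ^ a)⁻¹) *
        ∏ i : Fin k.length, ENNReal.ofReal (((n i : ℝ) ^ k.get i)⁻¹) := by
    rw [Fin.prod_univ_succ]
    simp
  unfold mzvTerm
  simp only [List.length_cons] at *
  rw [hprod]
  simp only [hiff]
  unfold w
  split_ifs <;> simp_all

lemma tsum_cons (l : ℕ) (f : (Fin (l + 1) → ℕ) → ℝ≥0∞) :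
    ∑' n, f n = ∑' m : ℕ, ∑' n : Fin l → ℕ, f (Fin.cons m n) := by
  rw [← ENNReal.tsum_prod, ← (Fin.consEquiv (fun _ : Fin (l + 1) => ℕ)).tsum_eq]
  rfl

lemma term_W (k : List ℕ) : ∀ N : ℕ,
    ∑' n : Fin k.length → ℕ, (if ∀ i, n i < N then mzvTerm k n else 0) = W k N (fun _ => 1) := by
  induction k with
  | nil =>
    intro N
    rw [tsum_eq_single (fun i => 0)]
    · simp [W, mzvTerm]
    · intro b hb
      exact absurd (funext fun i => i.elim0) hb
  | cons a k ih =>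
    intro N
    have := tsum_cons k.length (fun n => if ∀ i, n i < N then mzvTerm (a :: k) n else 0)
    refine Eq.trans this ?_
    simp only [W]
    rw [tsum_eq_sum (s := range N)]
    · refine Finset.sum_congr rfl fun m hm => ?_
      have hm := mem_range.1 hm
      rw [← ih, ← ENNReal.tsum_mul_left]
      refine tsum_congr fun n => ?_
      rw [term_cons]
      simp only [Fin.forall_fin_succ, Fin.cons_zero, Fin.cons_succ]
      by_cases h : ∀ i, n i < m
      · have h' : ∀ i, n i < N := fun i => (h i).trans hm
        simp [h, h', hm]
      · simp [h]
    · intro m hm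
      have hm : ¬ m < N := by simpa using hm
      simp [Fin.forall_fin_succ, hm]

lemma mzv_eq (a : ℕ) (k : List ℕ) : mzv (a :: k) = (Z a k).toReal := by
  have h1 : Z a k = ∑' n, mzvTerm (a :: k) n := by
    refine Eq.trans ?_ (tsum_cons k.length (mzvTerm (a :: k))).symm
    unfold Z
    refine tsum_congr fun m => ?_
    rw [← term_W, ← ENNReal.tsum_mul_left]
    refine tsum_congr fun n => ?_
    rw [term_cons]
  rw [h1, ENNReal.tsum_toReal_eq]
  · unfold mzv
    refine tsum_congr fun n => ?_
    unfold mzvTerm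
    split_ifs
    · rw [ENNReal.toReal_prod]
      refine Finset.prod_congr rfl fun i _ => ?_
      rw [ENNReal.toReal_ofReal (by positivity)]
    · simp
  · intro n
    unfold mzvTerm
    split_ifs
    · exact ENNReal.prod_ne_top fun i _ => ENNReal.ofReal_ne_top
    · simp

end CSum

open CSum
/-- **Cyclic sum theorem, form (1).**  For positive integers `k₁,…,k_l` with some `k_i ≥ 2`,
`∑_{j=1}^l ζ(k_j+1, k_{j+1},…,k_l,k₁,…,k_{j-1})
  = ∑_{j : k_j ≥ 2} ∑_{q=0}^{k_j-2} ζ(k_j-q, k_{j+1},…,k_l,k₁,…,k_{j-1}, q+1)`.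
The cyclic shift starting at position `j` is `k.rotate j`. -/
theorem cyclic_sum_theorem_form1 (k : List ℕ) (hne : k ≠ [])
    (hpos : ∀ a ∈ k, 1 ≤ a) (h2 : ∃ a ∈ k, 2 ≤ a) :
    ∑ j ∈ Finset.range k.length,
        mzv (((k.rotate j).headI + 1) :: (k.rotate j).tail) =
      ∑ j ∈ Finset.range k.length,
        ∑ q ∈ Finset.range ((k.rotate j).headI - 1),
          mzv (((k.rotate j).headI - q) :: ((k.rotate j).tail ++ [q + 1])) := by
  have hdec : ∀ j, ∃ a t, k.rotate j = a :: t ∧ 1 ≤ a ∧ (∀ b ∈ t, 1 ≤ b) := by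
    intro j
    have hn : k.rotate j ≠ [] := by simpa using hne
    obtain ⟨a, t, h⟩ := List.exists_cons_of_ne_nil hn
    have hp : ∀ b ∈ k.rotate j, 1 ≤ b := fun b hb => hpos b (by simpa using hb)
    rw [h] at hp
    exact ⟨a, t, h, hp a (by simp), fun b hb => hp b (by simp [hb])⟩
  have hrel : ∀ j, TL (k.rotate j) + ∑ q ∈ Finset.range ((k.rotate j).headI - 1),
      Z ((k.rotate j).headI - q) ((k.rotate j).tail ++ [q + 1])
      = Z ((k.rotate j).headI + 1) (k.rotate j).tail + TL (k.rotate (j + 1)) := by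
    intro j
    obtain ⟨a, t, h, ha, _⟩ := hdec j
    have h' : k.rotate (j + 1) = t ++ [a] := by
      rw [← List.rotate_rotate, h]; simp
    rw [h', h]
    exact main_rel a ha t
  have hZ : ∀ j, Z ((k.rotate j).headI + 1) (k.rotate j).tail ≠ ⊤ := by
    intro j
    obtain ⟨a, t, h, ha, ht⟩ := hdec j
    rw [h]
    exact Z_fin _ (by simpa using ha) _ ht
  have hZ2 : ∀ j, ∀ q ∈ Finset.range ((k.rotate j).headI - 1),
      Z ((k.rotate j).headI - q) ((k.rotate j).tail ++ [q + 1]) ≠ ⊤ := by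
    intro j q hq
    obtain ⟨a, t, h, ha, ht⟩ := hdec j
    rw [h] at hq ⊢
    simp only [List.headI_cons, List.tail_cons, Finset.mem_range] at hq ⊢
    refine Z_fin _ (by omega) _ ?_
    intro b hb
    rcases List.mem_append.1 hb with hb | hb
    · exact ht b hb
    · have := List.mem_singleton.1 hb
      omega
  have hback : ∀ j, TL (k.rotate (j + 1)) ≠ ⊤ → TL (k.rotate j) ≠ ⊤ := by
    intro j hj
    refine ne_top_of_le_ne_top (ENNReal.add_ne_top.2 ⟨hZ j, hj⟩) ?_
    rw [← hrel j]
    exact le_self_add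
  have hdown : ∀ i j, TL (k.rotate (j + i)) ≠ ⊤ → TL (k.rotate j) ≠ ⊤ := by
    intro i
    induction i with
    | zero => intro j h; exact h
    | succ i ih => intro j h; exact ih j (hback _ h)
  have h0 : TL (k.rotate 0) ≠ ⊤ := by
    obtain ⟨b, hb, hb2⟩ := h2
    obtain ⟨s, t, rfl⟩ := List.append_of_mem hb
    refine hdown s.length 0 ?_
    rw [zero_add, List.rotate_append_length_eq]
    refine T_fin b hb2 _ fun c hc => hpos c ?_
    have hc' : c ∈ t ++ s := hc
    simp only [List.mem_append, List.mem_cons] at hc' ⊢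
    tauto
  have hT : ∀ j ∈ Finset.range k.length, TL (k.rotate j) ≠ ⊤ := by
    intro j hj
    have hj := Finset.mem_range.1 hj
    refine hdown (k.length - j) j ?_
    rw [Nat.add_sub_cancel' hj.le, List.rotate_length]
    simpa using h0
  have hT' : ∑ j ∈ Finset.range k.length, TL (k.rotate j) ≠ ⊤ := ENNReal.sum_ne_top.2 hT
  have hshift : ∑ j ∈ Finset.range k.length, TL (k.rotate (j + 1))
      = ∑ j ∈ Finset.range k.length, TL (k.rotate j) := by
    have e1 := Finset.sum_range_succ (fun j => TL (k.rotate j)) k.length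
    have e2 := Finset.sum_range_succ' (fun j => TL (k.rotate j)) k.length
    rw [e1, List.rotate_length, List.rotate_zero] at e2
    refine ((ENNReal.add_left_inj ?_).1 e2).symm
    simpa using h0
  have key : ∑ j ∈ Finset.range k.length, Z ((k.rotate j).headI + 1) (k.rotate j).tail
      = ∑ j ∈ Finset.range k.length, ∑ q ∈ Finset.range ((k.rotate j).headI - 1),
      Z ((k.rotate j).headI - q) ((k.rotate j).tail ++ [q + 1]) := by
    have := Finset.sum_congr (rfl : Finset.range k.length = _) fun j _ => hrel j
    rw [Finset.sum_add_distrib, Finset.sum_add_distrib, hshift, add_comm] at this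
    exact ((ENNReal.add_left_inj hT').1 this).symm
  simp only [mzv_eq]
  rw [← ENNReal.toReal_sum (fun j _ => hZ j), key,
    ENNReal.toReal_sum (fun j _ => ENNReal.sum_ne_top.2 (hZ2 j))]
  exact Finset.sum_congr rfl fun j _ => ENNReal.toReal_sum (hZ2 j)
end

section
/- (Cyclic sum theorem, form (2).) Let s = (k₁,…,k_l) be an admissible sequence of weight n = k₁+⋯+k_l, let [s] denote the set of distinct cyclic permutations of s, and let [τ(s)] denote the set of distinct cyclic permutations of the dual sequence τ(s) (which has length n−l). Then ∑_{(p₁,…,p_l) ∈ [s]} ζ(p₁+1, p₂,…,p_l) = ∑_{(q₁,…,q_{n−l}) ∈ [τ(s)]} ζ(q₁+1, q₂,…,q_{n−l}). -/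
/-- Partial sums Σ(s) = (k₁, k₁+k₂, …, k₁+⋯+k_l). -/
def partialSums (k : List ℕ) : List ℕ :=
  (List.range k.length).map fun i => (k.take (i + 1)).sum

/-- Inverse of `partialSums`: the sequence of successive differences. -/
def unPartial (a : List ℕ) : List ℕ :=
  List.zipWith (· - ·) a (0 :: a)

/-- The dual sequence τ(s) = Σ⁻¹(C_n(R_n(Σ(s)))) of an admissible sequence `s` of weight `n`,
where `R_n(a₁,…,a_i) = (n+1-a_i,…,n+1-a₁)` and `C_n` takes the complement in `{1,…,n}`
in increasing order. -/
def dualSeq (k : List ℕ) : List ℕ :=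
  let n := k.sum
  let r := (partialSums k).reverse.map fun a => n + 1 - a
  let c := ((List.range n).map (· + 1)).filter fun m => m ∉ r
  unPartial c

/-- The set of distinct cyclic permutations of a list (as a `Finset`). -/
def cycClass (k : List ℕ) : Finset (List ℕ) :=
  (Finset.range k.length).image fun j => k.rotate j

open scoped ENNReal

namespace CycSum

/-- reciprocal of a natural number as an extended nonnegative real, with `rec 0 = 0`. -/
noncomputable def rc (n : ℕ) : ℝ≥0∞ := ENNReal.ofReal ((n : ℝ)⁻¹)

/-- transfer kernel of a word (`false` is the letter x and `true` the letter y). -/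
noncomputable def ker : List Bool → ℕ → ℕ → ℝ≥0∞
  | [], n, m => if n = m then 1 else 0
  | false :: u, n, m => rc n * ker u n m
  | true :: u, n, m => rc n * ∑ a ∈ Finset.range n, ker u a m

/-- zeta value of a word -/
noncomputable def zw (u : List Bool) : ℝ≥0∞ := ∑' n, ker u n 0

theorem rc_zero : rc 0 = 0 := by simp [rc]

theorem rc_ne_top (n : ℕ) : rc n ≠ ⊤ := by simp [rc]

theorem rc_le_one (n : ℕ) : rc n ≤ 1 := by
  unfold rc
  rw [ENNReal.ofReal_le_one]
  exact Nat.cast_inv_le_one n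

theorem sum_range_eq (f : ℕ → ℝ≥0∞) (n : ℕ) :
    ∑ a ∈ Finset.range n, f a = ∑' a, if a < n then f a else 0 := by
  rw [tsum_eq_sum (s := Finset.range n)]
  · refine Finset.sum_congr rfl fun a ha => ?_
    simp [Finset.mem_range.1 ha]
  · intro b hb
    simp at hb
    simp [hb]

theorem tsum_tail (f : ℕ → ℝ≥0∞) (j : ℕ) :
    ∑' n, (if j < n then f n else 0) = ∑' i, f (i + j + 1) := by
  have hinj : Function.Injective (fun i : ℕ => i + j + 1) := fun a b h => by simpa using h
  rw [← hinj.tsum_eq]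
  · refine tsum_congr fun i => ?_
    rw [if_pos (by omega)]
  · intro n hn
    rw [Function.mem_support] at hn
    by_cases h : j < n
    · exact ⟨n - j - 1, by simp; omega⟩
    · simp [h] at hn

theorem tsum_telescope (g : ℕ → ℝ) (h : ℕ → ℝ) (j : ℕ)
    (hg : Filter.Tendsto g Filter.atTop (nhds 0)) (hh : ∀ n, 0 ≤ h n)
    (he : ∀ n, j ≤ n → h (n + 1) = g n - g (n + 1)) :
    ∑' n, (if j < n then ENNReal.ofReal (h n) else 0) = ENNReal.ofReal (g j) := by
  rw [tsum_tail]
  have hs : HasSum (fun i => h (i + j + 1)) (g j) := by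
    rw [hasSum_iff_tendsto_nat_of_nonneg (fun i => hh _)]
    have : ∀ n, ∑ i ∈ Finset.range n, h (i + j + 1) = g j - g (n + j) := by
      intro n
      induction n with
      | zero => simp
      | succ n ih =>
        rw [Finset.sum_range_succ, ih, he _ (by omega)]
        rw [show n + 1 + j = n + j + 1 by omega]; ring
    simp_rw [this]
    have := (hg.comp (Filter.tendsto_add_atTop_nat j)).const_sub (g j)
    simpa using this
  rw [← hs.tsum_eq, ENNReal.ofReal_tsum_of_nonneg (fun i => hh _) hs.summable]

theorem ker_append_x (u : List Bool) (n m : ℕ) : ker (u ++ [false]) n m = ker u n m * rc m := by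
  induction u generalizing n with
  | nil => by_cases h : n = m <;> simp [ker, h]
  | cons c u ih =>
    cases c
    · simp [ker, ih, mul_assoc]
    · simp [ker, ih, mul_assoc, Finset.sum_mul]

theorem ker_append_y (u : List Bool) (n m : ℕ) :
    ker (u ++ [true]) n m = ∑' a, ker u n a * (if m < a then rc a else 0) := by
  induction u generalizing n with
  | nil =>
    rw [tsum_eq_single n]
    · by_cases h : m < n <;> simp [ker, h]
    · intro b hb
      simp [ker, hb.symm]
  | cons c u ih =>
    cases c
    · simp only [ker, ih, mul_assoc, List.cons_append]
      rw [ENNReal.tsum_mul_left]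
    · simp only [ker, ih, mul_assoc, List.cons_append, Finset.sum_mul]
      rw [ENNReal.tsum_mul_left, Summable.tsum_finsetSum (fun _ _ => ENNReal.summable)]

theorem ker_eq_zero (u : List Bool) (n m : ℕ) (h : n < m) : ker u n m = 0 := by
  induction u generalizing n with
  | nil => simp [ker, h.ne]
  | cons c u ih =>
    cases c
    · simp [ker, ih n h]
    · simp only [ker]
      rw [Finset.sum_eq_zero, mul_zero]
      intro a ha
      exact ih a (by simp at ha; omega)

theorem ker_eq_zero' (u : List Bool) (hu : true ∈ u) (n m : ℕ) (h : n ≤ m) : ker u n m = 0 := by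
  induction u generalizing n with
  | nil => simp at hu
  | cons c u ih =>
    cases c
    · simp [ker, ih (by simpa using hu) n h]
    · simp only [ker]
      rw [Finset.sum_eq_zero, mul_zero]
      intro a ha
      exact ker_eq_zero u a m (by simp at ha; omega)

theorem ker_zero_zero (u : List Bool) (hu : u ≠ []) (m : ℕ) : ker u 0 m = 0 := by
  cases u with
  | nil => simp at hu
  | cons c u => cases c <;> simp [ker, rc_zero]

/-! Duality -/

noncomputable def cn (m n : ℕ) : ℝ≥0∞ :=
  ENNReal.ofReal ((m.factorial : ℝ) * n.factorial / (m + n).factorial)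

theorem cn_comm (m n : ℕ) : cn m n = cn n m := by
  unfold cn; rw [mul_comm, add_comm m n]

theorem cn_zero (m : ℕ) : cn m 0 = 1 := by
  unfold cn; simp [Nat.factorial_ne_zero]

theorem cn_sum (m j : ℕ) (hm : 1 ≤ m) :
    ∑' n, (if j < n then rc n * cn m n else 0) = rc m * cn m j := by
  set g : ℕ → ℝ := fun n => (m : ℝ)⁻¹ * ((m.factorial : ℝ) * n.factorial / (m + n).factorial) with hg
  set h : ℕ → ℝ := fun n => (n : ℝ)⁻¹ * ((m.factorial : ℝ) * n.factorial / (m + n).factorial) with hh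
  have h1 : ∀ n, rc n * cn m n = ENNReal.ofReal (h n) := by
    intro n
    simp only [rc, cn, hh]
    rw [ENNReal.ofReal_mul (by positivity)]
  have h2 : rc m * cn m j = ENNReal.ofReal (g j) := by
    simp only [rc, cn, hg]
    rw [ENNReal.ofReal_mul (by positivity)]
  rw [h2]
  simp_rw [h1]
  apply tsum_telescope g h j
  · have hb : ∀ n, (m.factorial : ℝ) * n.factorial / (m + n).factorial ≤ 1 / (n + 1 : ℝ) := by
      intro n
      rw [div_le_div_iff₀ (by positivity) (by positivity)]
      have h3 := Nat.add_choose_mul_factorial_mul_factorial m n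
      have h4 : n + 1 ≤ (m + n).choose n := by
        calc n + 1 = (n + 1).choose 1 := by simp
          _ = (n+1).choose n := by rw [Nat.choose_symm_add]
          _ ≤ (m + n).choose n := Nat.choose_le_choose _ (by omega)
      have : m.factorial * n.factorial * (n + 1) ≤ 1 * (m+n).factorial := by
        rw [← h3]; nlinarith [Nat.mul_le_mul_right (m.factorial * n.factorial) h4]
      exact_mod_cast this
    have ht : Filter.Tendsto (fun n : ℕ => (m : ℝ)⁻¹ * (1 / ((n : ℝ) + 1))) Filter.atTop (nhds 0) := by
      simpa using (tendsto_one_div_add_atTop_nhds_zero_nat (𝕜 := ℝ)).const_mul ((m : ℝ)⁻¹)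
    refine squeeze_zero (fun n => by positivity) (fun n => ?_) ht
    exact mul_le_mul_of_nonneg_left (hb n) (by positivity)
  · intro n; positivity
  · intro n _
    simp only [hg, hh]
    have : (m:ℝ) ≠ 0 := by positivity
    have : (m:ℝ) + n + 1 ≠ 0 := by positivity
    rw [show m + (n + 1) = m + n + 1 by omega, Nat.factorial_succ (m+n), Nat.factorial_succ n]
    push_cast
    field_simp
    ring

/-- connected sum -/
noncomputable def conn (f g : ℕ → ℝ≥0∞) : ℝ≥0∞ := ∑' m, ∑' n, f m * g n * cn m n

theorem conn_comm (f g : ℕ → ℝ≥0∞) : conn f g = conn g f := by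
  unfold conn
  rw [ENNReal.tsum_comm]
  refine tsum_congr fun a => tsum_congr fun b => ?_
  rw [cn_comm]; ring

theorem conn_transport (f g : ℕ → ℝ≥0∞) (hf : f 0 = 0) :
    conn (fun m => rc m * f m) g = conn f (fun n => rc n * ∑ a ∈ Finset.range n, g a) := by
  unfold conn
  refine tsum_congr fun m => ?_
  rcases Nat.eq_zero_or_pos m with rfl | hm
  · simp [hf]
  have : ∀ n, f m * (rc n * ∑ a ∈ Finset.range n, g a) * cn m n
      = ∑' a, f m * g a * (if a < n then rc n * cn m n else 0) := by
    intro n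
    rw [sum_range_eq, ← ENNReal.tsum_mul_left, ← ENNReal.tsum_mul_left, ← ENNReal.tsum_mul_right]
    refine tsum_congr fun a => ?_
    split_ifs <;> ring
  simp_rw [this]
  rw [ENNReal.tsum_comm]
  refine tsum_congr fun a => ?_
  rw [ENNReal.tsum_mul_left, cn_sum m a hm]
  ring

theorem conn_nil (f : ℕ → ℝ≥0∞) : conn f (fun n => ker [] n 0) = ∑' m, f m := by
  unfold conn
  refine tsum_congr fun m => ?_
  rw [tsum_eq_single 0]
  · simp [ker, cn_zero]
  · intro b hb; simp [ker, hb]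

/-- dual word -/
def dw (u : List Bool) : List Bool := (u.map not).reverse

theorem conn_words (u v : List Bool) (hu : u.getLast? ≠ some false) (hv : v ≠ []) :
    conn (fun n => ker u n 0) (fun n => ker v n 0) = zw (dw u ++ v) := by
  induction u generalizing v with
  | nil => rw [conn_comm, conn_nil]; simp [zw, dw]
  | cons c u ih =>
    have hu' : u.getLast? ≠ some false := by
      cases u with
      | nil => simp
      | cons => simpa using hu
    cases c
    · have hne : u ≠ [] := by rintro rfl; simp at hu
      have := ih (true :: v) hu' (by simp)
      simp only [ker] at this ⊢
      rw [conn_transport (fun n => ker u n 0) _ (ker_zero_zero u hne 0), this]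
      simp [dw]
    · have := ih (false :: v) hu' (by simp)
      simp only [ker] at this ⊢
      rw [conn_comm, ← conn_transport (fun n => ker v n 0) _ (ker_zero_zero v hv 0), conn_comm, this]
      simp [dw]

theorem duality (u : List Bool) (hu : u.getLast? = some true) :
    zw (false :: u) = zw (dw (false :: u)) := by
  have hne : u ≠ [] := by rintro rfl; simp at hu
  have h1 := conn_words u [true] (by simp [hu]) (by simp)
  have h2 := conn_nil (fun n => ker (false :: u) n 0)
  simp only [ker] at h1 h2
  rw [conn_transport (fun n => ker u n 0) _ (ker_zero_zero u hne 0), h1] at h2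
  simp only [zw, dw] at *
  simp only [ker] at *
  rw [← h2]
  simp
end CycSum

namespace CycSum
/-! Cyclic sums -/

/-- the Hoffman-Ohno sum attached to a word -/
noncomputable def ho (w : List Bool) : ℝ≥0∞ :=
  ∑' m, ∑' n, if m = 0 then 0 else ker w n m * rc (n - m)

theorem zw_xuy (u : List Bool) :
    zw (false :: (u ++ [true])) = ∑' m, ∑' n, rc n * ker u n m * rc m := by
  unfold zw
  rw [ENNReal.tsum_comm]
  refine tsum_congr fun n => ?_
  simp only [ker, ker_append_y]
  rw [← ENNReal.tsum_mul_left]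
  refine tsum_congr fun a => ?_
  rcases Nat.eq_zero_or_pos a with rfl | h
  · simp [rc_zero]
  · simp [h, mul_assoc]

theorem rc_pf (n m : ℕ) (hm : 0 < m) (hn : m < n) :
    rc n * rc (n - m) + rc n * rc m = rc m * rc (n - m) := by
  unfold rc
  rw [← ENNReal.ofReal_mul (by positivity), ← ENNReal.ofReal_mul (by positivity),
    ← ENNReal.ofReal_mul (by positivity), ← ENNReal.ofReal_add (by positivity) (by positivity)]
  congr 1
  rw [Nat.cast_sub hn.le]
  have h1 : (m : ℝ) ≠ 0 := by positivity
  have h2 : (n : ℝ) ≠ 0 := by have : 0 < n := by omega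
                              positivity
  have h3 : (n : ℝ) - m ≠ 0 := by
    have : (m : ℝ) < n := by exact_mod_cast hn
    linarith
  field_simp
  ring

theorem ho_x (u : List Bool) (hu : true ∈ u) :
    ho (false :: u) + zw (false :: (u ++ [true])) = ho (u ++ [false]) := by
  rw [zw_xuy]
  unfold ho
  rw [← ENNReal.tsum_add]
  refine tsum_congr fun m => ?_
  rw [← ENNReal.tsum_add]
  refine tsum_congr fun n => ?_
  rcases Nat.eq_zero_or_pos m with rfl | hm
  · simp [rc_zero]
  rw [if_neg hm.ne', if_neg hm.ne', ker_append_x]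
  simp only [ker]
  by_cases h : m < n
  · have := rc_pf n m hm h
    calc _ = ker u n m * (rc n * rc (n - m) + rc n * rc m) := by ring
      _ = _ := by rw [this]; ring
  · rw [ker_eq_zero' u hu n m (by omega)]; simp

theorem rc_sum (a m : ℕ) (hm : 0 < m) (ha : m ≤ a) :
    ∑' n, (if a < n then rc n * rc (n - m) else 0) = rc m * ∑ j ∈ Finset.range m, rc (a - j) := by
  set g : ℕ → ℝ := fun n => (m : ℝ)⁻¹ * ∑ j ∈ Finset.range m, ((n - j : ℕ) : ℝ)⁻¹ with hg
  set h : ℕ → ℝ := fun n => (n : ℝ)⁻¹ * ((n - m : ℕ) : ℝ)⁻¹ with hh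
  have h1 : ∀ n, rc n * rc (n - m) = ENNReal.ofReal (h n) := by
    intro n
    simp only [rc, hh]
    rw [ENNReal.ofReal_mul (by positivity)]
  have h2 : rc m * ∑ j ∈ Finset.range m, rc (a - j) = ENNReal.ofReal (g a) := by
    simp only [rc, hg]
    rw [ENNReal.ofReal_mul (by positivity), ENNReal.ofReal_sum_of_nonneg]
    intros; positivity
  rw [h2]
  simp_rw [h1]
  apply tsum_telescope g h a
  · have : Filter.Tendsto g Filter.atTop (nhds ((m : ℝ)⁻¹ * ∑ j ∈ Finset.range m, 0)) := by
      apply Filter.Tendsto.const_mul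
      apply tendsto_finsetSum
      intro j _
      exact tendsto_inv_atTop_nhds_zero_nat.comp (Filter.tendsto_sub_atTop_nat j)
    simpa using this
  · intro n; positivity
  · intro n hn
    simp only [hg, hh]
    rw [← mul_sub, ← Finset.sum_sub_distrib]
    have key : ∀ k, k ≤ n → ∑ j ∈ Finset.range k, (((n - j : ℕ) : ℝ)⁻¹ - ((n + 1 - j : ℕ) : ℝ)⁻¹)
        = ((n + 1 - k : ℕ) : ℝ)⁻¹ - ((n + 1 : ℕ) : ℝ)⁻¹ := by
      intro k hk
      induction k with
      | zero => simp
      | succ k ih =>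
        rw [Finset.sum_range_succ, ih (by omega), show n + 1 - (k + 1) = n - k by omega]
        ring
    rw [key m (by omega), Nat.cast_sub (by omega)]
    have h1 : (m : ℝ) ≠ 0 := by positivity
    have h3 : ((n + 1 : ℕ) : ℝ) - m ≠ 0 := by
      have : (m : ℝ) < ((n + 1 : ℕ) : ℝ) := by exact_mod_cast (by omega)
      linarith
    have h4 : ((n + 1 : ℕ) : ℝ) ≠ 0 := by positivity
    field_simp
    ring

theorem ho_y (u : List Bool) :
    ho (true :: u) = ho (u ++ [true]) + zw (false :: (u ++ [true])) := by
  -- right side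
  have hR : ho (u ++ [true]) + zw (false :: (u ++ [true]))
      = ∑' j, ∑' a, ker (u ++ [true]) a j * rc (a - j) := by
    rw [ENNReal.tsum_eq_add_tsum_ite 0 (f := fun j => ∑' a, ker (u ++ [true]) a j * rc (a - j)),
      add_comm]
    congr 1
    · unfold zw
      refine tsum_congr fun n => ?_
      simp [ker, mul_comm]
    · unfold ho
      refine tsum_congr fun m => ?_
      split_ifs <;> simp
  rw [hR]
  simp_rw [ker_append_y]
  have hR2 : ∑' j, ∑' a, (∑' m, ker u a m * (if j < m then rc m else 0)) * rc (a - j)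
      = ∑' m, ∑' a, ker u a m * (rc m * ∑ j ∈ Finset.range m, rc (a - j)) := by
    simp_rw [← ENNReal.tsum_mul_right]
    rw [ENNReal.tsum_comm]
    rw [ENNReal.tsum_comm (f := fun m a => ker u a m * (rc m * ∑ j ∈ Finset.range m, rc (a - j)))]
    refine tsum_congr fun a => ?_
    rw [ENNReal.tsum_comm]
    refine tsum_congr fun m => ?_
    rw [sum_range_eq, ← ENNReal.tsum_mul_left, ← ENNReal.tsum_mul_left]
    refine tsum_congr fun j => ?_
    split_ifs <;> ring
  rw [hR2]
  unfold ho
  refine tsum_congr fun m => ?_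
  rcases Nat.eq_zero_or_pos m with rfl | hm
  · simp
  simp only [if_neg hm.ne', ker]
  have : ∀ n, rc n * (∑ a ∈ Finset.range n, ker u a m) * rc (n - m)
      = ∑' a, ker u a m * (if a < n then rc n * rc (n - m) else 0) := by
    intro n
    rw [sum_range_eq, ← ENNReal.tsum_mul_left, ← ENNReal.tsum_mul_right]
    refine tsum_congr fun a => ?_
    split_ifs <;> ring
  simp_rw [this]
  rw [ENNReal.tsum_comm]
  refine tsum_congr fun a => ?_
  rw [ENNReal.tsum_mul_left]
  by_cases h : m ≤ a
  · rw [rc_sum a m hm h]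
  · rw [ker_eq_zero u a m (by omega)]; simp

/-! Finiteness -/

/-- harmonic numbers -/
noncomputable def hm (n : ℕ) : ℝ≥0∞ := ∑ a ∈ Finset.range n, rc (a + 1)

theorem hm_one_le (n : ℕ) (hn : 1 ≤ n) : 1 ≤ hm n := by
  unfold hm
  calc (1 : ℝ≥0∞) = rc (0 + 1) := by simp [rc]
    _ ≤ _ := Finset.single_le_sum (f := fun a => rc (a + 1)) (fun _ _ => zero_le) (by simp; omega)

theorem hm_mono {a b : ℕ} (h : a ≤ b) : hm a ≤ hm b :=
  Finset.sum_le_sum_of_subset (by simpa using h)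

theorem sum_rc_le (n : ℕ) : ∑ a ∈ Finset.range n, rc a ≤ hm n := by
  cases n with
  | zero => simp
  | succ n =>
    rw [Finset.sum_range_succ', rc_zero, add_zero]
    exact hm_mono (Nat.le_succ n)

theorem ker_le_one_or (u : List Bool) (hu : true ∉ u) (n m : ℕ) :
    ker u n m ≤ if n = m then 1 else 0 := by
  induction u with
  | nil => simp [ker]
  | cons c u ih =>
    cases c
    · simp only [ker]
      calc _ ≤ 1 * ker u n m := by gcongr; exact rc_le_one n
        _ ≤ _ := by rw [one_mul]; exact ih (by simpa using hu)
    · simp at hu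

theorem ker_bound (u : List Bool) (hu : true ∈ u) (n m : ℕ) :
    ker u n m ≤ rc n * hm n ^ u.length := by
  rcases Nat.eq_zero_or_pos n with rfl | hn
  · rw [ker_zero_zero u (by rintro rfl; simp at hu)]; simp
  induction u generalizing n with
  | nil => simp at hu
  | cons c u ih =>
    have h1 := hm_one_le n hn
    cases c
    · simp only [ker, List.length_cons]
      calc _ ≤ 1 * (rc n * hm n ^ u.length) := by
            gcongr
            · exact rc_le_one n
            · exact ih (by simpa using hu) n hn
        _ ≤ _ := by rw [one_mul]; gcongr; exact Nat.le_succ _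
    · simp only [ker, List.length_cons]
      gcongr
      by_cases h : true ∈ u
      · calc _ ≤ ∑ a ∈ Finset.range n, rc a * hm n ^ u.length := by
              refine Finset.sum_le_sum fun a ha => ?_
              rcases Nat.eq_zero_or_pos a with rfl | ha'
              · rw [ker_zero_zero u (by rintro rfl; simp at h)]; simp
              refine (ih h a ha').trans ?_
              gcongr
              exact hm_mono (by simp at ha; omega)
          _ ≤ hm n * hm n ^ u.length := by
              rw [← Finset.sum_mul]; gcongr; exact sum_rc_le n
          _ = _ := by ring
      · calc _ ≤ ∑ a ∈ Finset.range n, (if a = m then 1 else 0 : ℝ≥0∞) :=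
              Finset.sum_le_sum fun a _ => ker_le_one_or u h a m
          _ ≤ 1 := by
              rw [Finset.sum_ite_eq']; split_ifs <;> simp
          _ ≤ _ := one_le_pow₀ h1

theorem hm_eq (n : ℕ) : hm n = ENNReal.ofReal (harmonic n : ℝ) := by
  unfold hm harmonic rc
  push_cast
  rw [ENNReal.ofReal_sum_of_nonneg]
  intros; positivity

theorem fin_sum (p : ℕ) : ∑' n, rc n * rc n * hm n ^ p ≠ ⊤ := by
  have hb : (fun n : ℕ => ((n : ℝ)⁻¹ * (n : ℝ)⁻¹ * (1 + Real.log n) ^ p))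
      =O[Filter.atTop] (fun n : ℕ => (n : ℝ) ^ (-(3/2) : ℝ)) := by
    have h0 : (fun x : ℝ => (1 + Real.log x) ^ p) =O[Filter.atTop] (fun x : ℝ => x ^ (1/2 : ℝ)) := by
      have h1 : (fun x : ℝ => (1 + Real.log x)) =O[Filter.atTop] (fun x : ℝ => Real.log x) := by
        refine Asymptotics.IsBigO.add ?_ (Asymptotics.isBigO_refl _ _)
        exact (Real.isLittleO_const_log_atTop (c := 1)).isBigO
      have h2 := h1.pow p
      refine h2.trans ?_
      have h3 := isLittleO_log_rpow_rpow_atTop (s := 1/2) (p : ℝ) (by norm_num)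
      simpa using h3.isBigO
    have h1 := h0.comp_tendsto tendsto_natCast_atTop_atTop
    have h2 := (Asymptotics.isBigO_refl (fun n : ℕ => (n : ℝ)⁻¹ * (n : ℝ)⁻¹) Filter.atTop).mul h1
    refine h2.congr' (by rfl) ?_
    filter_upwards [Filter.eventually_gt_atTop 0] with n hn
    have hn' : (0 : ℝ) < n := by exact_mod_cast hn
    simp only [Function.comp]
    rw [← Real.rpow_neg_one, ← Real.rpow_add hn', ← Real.rpow_add hn']
    norm_num
  have hs : Summable (fun n : ℕ => ((n : ℝ)⁻¹ * (n : ℝ)⁻¹ * (1 + Real.log n) ^ p)) :=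
    summable_of_isBigO_nat (Real.summable_nat_rpow.2 (by norm_num)) hb
  have hle : ∀ n, rc n * rc n * hm n ^ p ≤
      ENNReal.ofReal ((n : ℝ)⁻¹ * (n : ℝ)⁻¹ * (1 + Real.log n) ^ p) := by
    intro n
    rcases Nat.eq_zero_or_pos n with rfl | hn
    · simp [rc_zero]
    have hh : (0:ℝ) ≤ harmonic n := by
      unfold harmonic; push_cast; positivity
    rw [ENNReal.ofReal_mul (by positivity), ENNReal.ofReal_mul (by positivity), hm_eq,
      ← ENNReal.ofReal_pow hh]
    unfold rc
    gcongr
    exact harmonic_le_one_add_log n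
  exact ne_top_of_le_ne_top hs.tsum_ofReal_ne_top (ENNReal.tsum_le_tsum hle)

theorem zw_fin (u : List Bool) (hu : true ∈ u) : zw (false :: u) ≠ ⊤ := by
  refine ne_top_of_le_ne_top (fin_sum u.length) ?_
  refine ENNReal.tsum_le_tsum fun n => ?_
  simp only [ker]
  rw [mul_assoc]
  gcongr
  exact ker_bound u hu n 0

theorem ho_fin (u : List Bool) (hu : true ∈ u) : ho (false :: u) ≠ ⊤ := by
  refine ne_top_of_le_ne_top (fin_sum (u.length + 1)) ?_
  unfold ho
  rw [ENNReal.tsum_comm]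
  refine ENNReal.tsum_le_tsum fun n => ?_
  calc _ ≤ ∑' m, rc n * (rc n * hm n ^ u.length) * (if m < n then rc (n - m) else 0) := by
        refine ENNReal.tsum_le_tsum fun m => ?_
        split_ifs with h1 h2 h2
        · simp
        · simp
        · simp only [ker]
          gcongr
          exact ker_bound u hu n m
        · rw [show n - m = 0 by omega, rc_zero]; simp
    _ = rc n * (rc n * hm n ^ u.length) * hm n := by
        rw [ENNReal.tsum_mul_left, ← sum_range_eq (fun m => rc (n - m))]
        congr 1
        unfold hm
        rw [← Finset.sum_range_reflect]
        refine Finset.sum_congr rfl fun j hj => ?_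
        simp at hj
        congr 1; omega
    _ = _ := by ring

end CycSum

namespace CycSum
/-! Link with `mzv` -/

/-- word of a sequence -/
def word (s : List ℕ) : List Bool := s.flatMap fun a => List.replicate (a - 1) false ++ [true]

theorem word_nil : word [] = [] := rfl

theorem word_cons (a : ℕ) (s : List ℕ) :
    word (a :: s) = List.replicate (a - 1) false ++ true :: word s := by
  simp [word]

theorem word_append (s t : List ℕ) : word (s ++ t) = word s ++ word t := by
  simp [word]

theorem ker_replicate (j : ℕ) (u : List Bool) (n m : ℕ) :
    ker (List.replicate j false ++ u) n m = rc n ^ j * ker u n m := by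
  induction j with
  | zero => simp
  | succ j ih =>
    rw [List.replicate_succ, List.cons_append]
    simp only [ker]
    rw [ih]; ring

/-- bounded multiple sums -/
noncomputable def bs (k : List ℕ) (N : ℕ) : ℝ≥0∞ :=
  ∑' n : Fin k.length → ℕ,
    if ((∀ i j : Fin k.length, i < j → n j < n i) ∧ (∀ i, 1 ≤ n i)) ∧ ∀ i, n i < N then
      ∏ i : Fin k.length, rc (n i) ^ k.get i
    else 0

/-- unbounded multiple sums -/
noncomputable def us (k : List ℕ) : ℝ≥0∞ :=
  ∑' n : Fin k.length → ℕ,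
    if ((∀ i j : Fin k.length, i < j → n j < n i) ∧ (∀ i, 1 ≤ n i)) then
      ∏ i : Fin k.length, rc (n i) ^ k.get i
    else 0

theorem mzv_eq (k : List ℕ) : mzv k = (us k).toReal := by
  unfold mzv us
  rw [ENNReal.tsum_toReal_eq]
  · refine tsum_congr fun n => ?_
    split_ifs
    · rw [ENNReal.toReal_prod]
      refine Finset.prod_congr rfl fun i _ => ?_
      rw [ENNReal.toReal_pow, rc, ENNReal.toReal_ofReal (by positivity), inv_pow]
    · simp
  · intro n
    split_ifs
    · exact ENNReal.prod_ne_top fun i _ => ENNReal.pow_ne_top (rc_ne_top _)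
    · simp

theorem tsum_fin_cons {l : ℕ} (f : (Fin (l + 1) → ℕ) → ℝ≥0∞) :
    ∑' n, f n = ∑' a : ℕ, ∑' n : Fin l → ℕ, f (Fin.cons a n) := by
  rw [← ENNReal.tsum_prod, ← (Fin.consEquiv (fun _ : Fin (l + 1) => ℕ)).tsum_eq]
  rfl

theorem cons_cond {l : ℕ} (a : ℕ) (n : Fin l → ℕ) :
    ((∀ i j : Fin (l + 1), i < j → (Fin.cons a n : Fin (l + 1) → ℕ) j < (Fin.cons a n : Fin (l + 1) → ℕ) i) ∧
      (∀ i, 1 ≤ (Fin.cons a n : Fin (l + 1) → ℕ) i)) ↔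
    (((∀ i j : Fin l, i < j → n j < n i) ∧ (∀ i, 1 ≤ n i)) ∧ ∀ i, n i < a) ∧ 1 ≤ a := by
  simp only [Fin.forall_fin_succ, Fin.cons_zero, Fin.cons_succ, Fin.succ_lt_succ_iff]
  simp
  tauto

theorem us_cons (a : ℕ) (k : List ℕ) (ha : 1 ≤ a) :
    us (a :: k) = ∑' n, rc n ^ a * bs k n := by
  unfold us
  simp only [List.length_cons]
  rw [tsum_fin_cons]
  refine tsum_congr fun b => ?_
  unfold bs
  rw [← ENNReal.tsum_mul_left]
  refine tsum_congr fun n => ?_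
  simp only [cons_cond, Fin.prod_univ_succ]
  rcases Nat.eq_zero_or_pos b with rfl | hb
  · simp [rc_zero]; intros; omega
  · have : 1 ≤ b := hb
    simp [this]

theorem bs_cons (a : ℕ) (k : List ℕ) (ha : 1 ≤ a) (N : ℕ) :
    bs (a :: k) N = ∑ n ∈ Finset.range N, rc n ^ a * bs k n := by
  rw [sum_range_eq]
  rw [bs]
  simp only [List.length_cons]
  rw [tsum_fin_cons]
  refine tsum_congr fun b => ?_
  have hc : ∀ n : Fin k.length → ℕ, ((((∀ i j : Fin k.length, i < j → n j < n i) ∧ (∀ i, 1 ≤ n i)) ∧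
        ∀ i, n i < b) ∧ 1 ≤ b) ∧ (∀ i : Fin (k.length + 1), (Fin.cons b n : Fin (k.length + 1) → ℕ) i < N) ↔
      ((((∀ i j : Fin k.length, i < j → n j < n i) ∧ (∀ i, 1 ≤ n i)) ∧
        ∀ i, n i < b) ∧ 1 ≤ b) ∧ b < N := by
    intro n
    simp only [Fin.forall_fin_succ, Fin.cons_zero, Fin.cons_succ]
    refine and_congr_right fun h => ⟨fun h' => h'.1, fun h' => ⟨h', fun i => ?_⟩⟩
    exact (h.1.2 i).trans h'
  simp only [cons_cond, hc]
  by_cases hN : b < N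
  · rw [if_pos hN]
    unfold bs
    rw [← ENNReal.tsum_mul_left]
    refine tsum_congr fun n => ?_
    simp only [Fin.prod_univ_succ]
    rcases Nat.eq_zero_or_pos b with rfl | hb
    · simp [rc_zero]; intros; omega
    · have : 1 ≤ b := hb
      simp [this, hN]
  · simp [hN]

theorem ker_word_cons (a : ℕ) (k : List ℕ) (ha : 1 ≤ a) (n : ℕ) :
    ker (word (a :: k)) n 0 = rc n ^ a * ∑ b ∈ Finset.range n, ker (word k) b 0 := by
  rw [word_cons, ker_replicate]
  simp only [ker]
  rw [← mul_assoc, ← pow_succ, Nat.sub_add_cancel ha]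

theorem bs_eq (k : List ℕ) (hk : ∀ a ∈ k, 1 ≤ a) (N : ℕ) (hN : 1 ≤ N) :
    bs k N = ∑ b ∈ Finset.range N, ker (word k) b 0 := by
  induction k generalizing N with
  | nil =>
    simp only [word_nil, ker]
    rw [Finset.sum_ite_eq', if_pos (by simp; omega)]
    unfold bs
    rw [tsum_eq_single (fun _ => 0)]
    · simp
    · intro n hn
      exact absurd (funext fun i => i.elim0) hn
  | cons a k ih =>
    rw [bs_cons a k (hk a (by simp))]
    refine Finset.sum_congr rfl fun n _ => ?_
    rw [ker_word_cons a k (hk a (by simp))]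
    rcases Nat.eq_zero_or_pos n with rfl | hn
    · have := hk a (by simp)
      rw [rc_zero, zero_pow (by omega)]; simp
    · rw [ih (fun b hb => hk b (by simp [hb])) n hn]

theorem mzv_word (a : ℕ) (k : List ℕ) (hk : ∀ b ∈ a :: k, 1 ≤ b) :
    mzv (a :: k) = (zw (word (a :: k))).toReal := by
  rw [mzv_eq, us_cons a k (hk a (by simp)), zw]
  congr 1
  refine tsum_congr fun n => ?_
  rw [ker_word_cons a k (hk a (by simp))]
  rcases Nat.eq_zero_or_pos n with rfl | hn
  · have := hk a (by simp)
    rw [rc_zero, zero_pow (by omega)]; simp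
  · rw [bs_eq k (fun b hb => hk b (by simp [hb])) n hn]

theorem mzv_shift (p : List ℕ) (hp : ∀ b ∈ p, 1 ≤ b) (hne : p ≠ []) :
    mzv ((p.headI + 1) :: p.tail) = (zw (false :: word p)).toReal := by
  cases p with
  | nil => simp at hne
  | cons a k =>
    have ha := hp a (by simp)
    simp only [List.headI, List.tail]
    rw [mzv_word]
    · congr 2
      rw [word_cons, word_cons, Nat.add_sub_cancel]
      obtain ⟨b, rfl⟩ : ∃ b, a = b + 1 := ⟨a - 1, by omega⟩
      simp [List.replicate_succ]
    · intro b hb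
      rcases List.mem_cons.1 hb with rfl | hb
      · omega
      · exact hp b (by simp [hb])

/-! Words and sequences -/

theorem word_last (s : List ℕ) : (word s).getLast? ≠ some false := by
  induction s with
  | nil => simp [word]
  | cons a s ih =>
    rw [word_cons]
    cases h : word s with
    | nil => simp
    | cons b t => rw [h] at ih; simpa using ih

theorem word_last' (s : List ℕ) (hs : s ≠ []) : (word s).getLast? = some true := by
  have h := word_last s
  have hne : word s ≠ [] := by
    cases s with
    | nil => simp at hs
    | cons => simp [word_cons]
  rw [List.getLast?_eq_some_getLast hne] at h ⊢
  simpa using h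

theorem word_inj (s t : List ℕ) (hs : ∀ b ∈ s, 1 ≤ b) (ht : ∀ b ∈ t, 1 ≤ b)
    (h : word s = word t) : s = t := by
  have aux : ∀ (i j : ℕ) (u v : List Bool), List.replicate i false ++ true :: u =
      List.replicate j false ++ true :: v → i = j ∧ u = v := by
    intro i
    induction i with
    | zero =>
      intro j u v h
      cases j with
      | zero => simpa using h
      | succ j => simp [List.replicate_succ] at h
    | succ i ih =>
      intro j u v h
      cases j with
      | zero => simp [List.replicate_succ] at h
      | succ j =>
        simp only [List.replicate_succ, List.cons_append, List.cons.injEq, true_and] at h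
        have := ih j u v h
        exact ⟨by omega, this.2⟩
  induction s generalizing t with
  | nil =>
    cases t with
    | nil => rfl
    | cons b t => simp [word_cons, word_nil] at h
  | cons a s ih =>
    cases t with
    | nil => simp [word_cons, word_nil] at h
    | cons b t =>
      rw [word_cons, word_cons] at h
      have h' := aux _ _ _ _ h
      have := hs a (by simp)
      have := ht b (by simp)
      rw [ih t (fun b hb => hs b (by simp [hb])) (fun b hb => ht b (by simp [hb])) h'.2]
      congr 1
      omega

theorem word_surj (u : List Bool) (hu : u.getLast? ≠ some false) :
    ∃ s : List ℕ, (∀ b ∈ s, 1 ≤ b) ∧ word s = u := by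
  induction u with
  | nil => exact ⟨[], by simp, rfl⟩
  | cons c u ih =>
    have hu' : u.getLast? ≠ some false := by
      cases u with
      | nil => simp
      | cons => simpa using hu
    obtain ⟨s, hs, hw⟩ := ih hu'
    cases c
    · cases s with
      | nil => rw [← hw] at hu; simp [word] at hu
      | cons a s =>
        refine ⟨(a + 1) :: s, ?_, ?_⟩
        · intro b hb
          rcases List.mem_cons.1 hb with rfl | hb
          · omega
          · exact hs b (by simp [hb])
        · have := hs a (by simp)
          rw [← hw, word_cons, word_cons]
          obtain ⟨b, rfl⟩ : ∃ b, a = b + 1 := ⟨a - 1, by omega⟩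
          simp [List.replicate_succ]
    · refine ⟨1 :: s, ?_, ?_⟩
      · intro b hb
        rcases List.mem_cons.1 hb with rfl | hb
        · omega
        · exact hs b hb
      · simp [word_cons, hw]

/-- rotation class of a word -/
def cw (w : List Bool) : Finset (List Bool) := (Finset.range w.length).image fun j => w.rotate j

theorem mem_image_rotate {α : Type*} [DecidableEq α] (w u : List α) (hw : w ≠ []) :
    u ∈ (Finset.range w.length).image (fun j => w.rotate j) ↔ w.IsRotated u := by
  simp only [Finset.mem_image, Finset.mem_range]
  constructor
  · rintro ⟨j, _, rfl⟩; exact ⟨j, rfl⟩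
  · rintro ⟨j, rfl⟩
    exact ⟨j % w.length, Nat.mod_lt _ (List.length_pos_iff.2 hw), List.rotate_mod w j⟩

theorem rot_split {α : Type*} (w u : List α) (h : w.IsRotated u) :
    ∃ A B, w = A ++ B ∧ u = B ++ A := by
  obtain ⟨n, hn, rfl⟩ := List.isRotated_iff_mod.1 h
  exact ⟨w.take n, w.drop n, by simp, List.rotate_eq_drop_append_take hn⟩

theorem word_rot (s : List ℕ) (hs : ∀ b ∈ s, 1 ≤ b) (u : List Bool)
    (h : (word s).IsRotated u) (hu : u.getLast? = some true) :
    ∃ p, s.IsRotated p ∧ word p = u := by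
  obtain ⟨A, B, hAB, rfl⟩ := rot_split _ _ h
  have hl := word_last s
  rw [hAB] at hl
  rw [List.getLast?_append] at hl hu
  have hA : A.getLast? ≠ some false := by
    intro h; rw [h] at hu; simp at hu
  have hB : B.getLast? ≠ some false := by
    intro h; rw [h] at hl; simp at hl
  obtain ⟨a, ha, rfl⟩ := word_surj A hA
  obtain ⟨b, hb, rfl⟩ := word_surj B hB
  rw [← word_append] at hAB
  have := word_inj s (a ++ b) hs (by
    intro c hc
    rcases List.mem_append.1 hc with hc | hc
    · exact ha c hc
    · exact hb c hc) hAB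
  subst this
  exact ⟨b ++ a, List.isRotated_append, word_append b a⟩

theorem rot_word (s p : List ℕ) (h : s.IsRotated p) : (word s).IsRotated (word p) := by
  obtain ⟨A, B, rfl, rfl⟩ := rot_split _ _ h
  rw [word_append, word_append]
  exact List.isRotated_append

theorem word_ne_nil (s : List ℕ) (hs : s ≠ []) : word s ≠ [] := by
  intro h
  have := word_last' s hs
  rw [h] at this; simp at this

theorem zw_class_fin (w u : List Bool) (hw : true ∈ w) (h : w.IsRotated u) : zw (false :: u) ≠ ⊤ :=
  zw_fin u (h.mem_iff.1 hw)

theorem sum_cyc (s : List ℕ) (hs : ∀ b ∈ s, 1 ≤ b) (hne : s ≠ []) :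
    ∑ p ∈ cycClass s, mzv ((p.headI + 1) :: p.tail) =
      (∑ u ∈ (cw (word s)).filter (fun u => u.getLast? = some true), zw (false :: u)).toReal := by
  have hwn := word_ne_nil s hne
  have hmem : ∀ p, p ∈ cycClass s ↔ s.IsRotated p := fun p => mem_image_rotate s p hne
  have hmem' : ∀ p, p ∈ cw (word s) ↔ (word s).IsRotated p := fun p => mem_image_rotate _ p hwn
  have htrue : true ∈ word s := by
    have := word_last' s hne
    exact List.mem_of_getLast? this
  have hpos : ∀ p, s.IsRotated p → ∀ b ∈ p, 1 ≤ b := fun p hp b hb => hs b (hp.mem_iff.2 hb)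
  have hpne : ∀ p, s.IsRotated p → p ≠ [] := by
    rintro p hp rfl
    exact hne (List.isRotated_nil_iff.1 hp)
  rw [ENNReal.toReal_sum]
  · refine Finset.sum_bij (fun p _ => word p) ?_ ?_ ?_ ?_
    · intro p hp
      rw [hmem] at hp
      rw [Finset.mem_filter, hmem']
      exact ⟨rot_word s p hp, word_last' p (hpne p hp)⟩
    · intro p hp q hq h
      rw [hmem] at hp hq
      exact word_inj p q (hpos p hp) (hpos q hq) h
    · intro u hu
      rw [Finset.mem_filter, hmem'] at hu
      obtain ⟨p, hp, h⟩ := word_rot s hs u hu.1 hu.2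
      exact ⟨p, (hmem p).2 hp, h⟩
    · intro p hp
      rw [hmem] at hp
      exact mzv_shift p (hpos p hp) (hpne p hp)
  · intro u hu
    rw [Finset.mem_filter, hmem'] at hu
    exact zw_class_fin _ _ htrue hu.1

/-! The cyclic sum formula on words -/

theorem ho_rot_fin (w : List Bool) (hy : true ∈ w) (h0 : ho w ≠ ⊤) (i : ℕ) :
    ho (w.rotate i) ≠ ⊤ := by
  induction i with
  | zero => simpa using h0
  | succ i ih =>
    rw [← List.rotate_rotate]
    have hy' : true ∈ w.rotate i := by simpa using hy
    cases h : w.rotate i with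
    | nil => rw [h] at hy'; simp at hy'
    | cons c u =>
      rw [h] at ih hy'
      simp only [List.rotate_cons_succ, List.rotate_zero]
      cases c
      · have hu : true ∈ u := by simpa using hy'
        rw [← ho_x u hu]
        exact ENNReal.add_ne_top.2 ⟨ih, zw_fin _ (by simp)⟩
      · rw [ho_y] at ih
        exact (ENNReal.add_ne_top.1 ih).1

theorem ho_step (v : List Bool) (hv : true ∈ v) :
    ho v + (if v.head? = some false then zw (v ++ [true]) else 0) =
    ho (v.rotate 1) + (if (v.rotate 1).getLast? = some true then zw (false :: v.rotate 1) else 0) := by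
  cases v with
  | nil => simp at hv
  | cons c u =>
    simp only [List.rotate_cons_succ, List.rotate_zero]
    cases c
    · have hu : true ∈ u := by simpa using hv
      simp [← ho_x u hu]
    · simp [ho_y u]

theorem cyc_words (w : List Bool) (hx : w.head? = some false) (hy : true ∈ w) :
    ∑ v ∈ (cw w).filter (fun v => v.head? = some false), zw (v ++ [true]) =
      ∑ u ∈ (cw w).filter (fun u => u.getLast? = some true), zw (false :: u) := by
  have hne : w ≠ [] := by rintro rfl; simp at hy
  have hmem : ∀ p, p ∈ cw w ↔ w.IsRotated p := fun p => mem_image_rotate _ p hne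
  have hrot : ∀ f : List Bool → ℝ≥0∞, ∑ v ∈ cw w, f (v.rotate 1) = ∑ v ∈ cw w, f v := by
    intro f
    refine Finset.sum_bij (fun v _ => v.rotate 1) ?_ ?_ ?_ ?_
    · intro v hv
      rw [hmem] at hv ⊢
      exact hv.trans ⟨1, rfl⟩
    · intro a _ b _ h
      exact List.rotate_injective 1 h
    · intro b hb
      rw [hmem] at hb
      have hbn : b ≠ [] := by
        rintro rfl
        exact hne (List.isRotated_nil_iff.1 hb)
      refine ⟨b.rotate (b.length - 1), ?_, ?_⟩
      · rw [hmem]; exact hb.trans ⟨_, rfl⟩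
      · have := List.length_pos_iff.2 hbn
        rw [List.rotate_rotate, Nat.sub_add_cancel this, List.rotate_length]
    · intros; rfl
  have hfin : ∑ v ∈ cw w, ho v ≠ ⊤ := by
    rw [ENNReal.sum_ne_top]
    intro v hv
    rw [hmem] at hv
    obtain ⟨i, rfl⟩ := hv
    refine ho_rot_fin w hy ?_ i
    cases w with
    | nil => simp at hx
    | cons c u =>
      simp at hx
      subst hx
      exact ho_fin u (by simpa using hy)
  have key : ∑ v ∈ cw w, (ho v + (if v.head? = some false then zw (v ++ [true]) else 0)) =
      ∑ v ∈ cw w, (ho v + (if v.getLast? = some true then zw (false :: v) else 0)) := by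
    rw [← hrot (fun v => ho v + (if v.getLast? = some true then zw (false :: v) else 0))]
    refine Finset.sum_congr rfl fun v hv => ho_step v ?_
    rw [hmem] at hv
    exact hv.mem_iff.1 hy
  rw [Finset.sum_add_distrib, Finset.sum_add_distrib] at key
  rw [Finset.sum_filter, Finset.sum_filter]
  exact (ENNReal.add_right_inj hfin).1 key

theorem dw_dw (u : List Bool) : dw (dw u) = u := by
  simp [dw, List.map_reverse, Function.comp_def]

theorem dual_words (w : List Bool) (hw : w ≠ []) :
    ∑ u ∈ (cw (dw w)).filter (fun u => u.getLast? = some true), zw (false :: u) =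
    ∑ v ∈ (cw w).filter (fun v => v.head? = some false), zw (v ++ [true]) := by
  have hw' : dw w ≠ [] := by simpa [dw] using hw
  have hmem : ∀ p, p ∈ cw w ↔ w.IsRotated p := fun p => mem_image_rotate _ p hw
  have hmem' : ∀ p, p ∈ cw (dw w) ↔ (dw w).IsRotated p := fun p => mem_image_rotate _ p hw'
  have hd : ∀ a b : List Bool, a.IsRotated b → (dw a).IsRotated (dw b) := fun a b h =>
    (h.map not).reverse
  have hh : ∀ u : List Bool, (dw u).head? = some false ↔ u.getLast? = some true := by
    intro u; simp [dw, List.getLast?_map]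
  refine Finset.sum_bij' (fun u _ => dw u) (fun u _ => dw u) ?_ ?_ ?_ ?_ ?_
  · intro u hu
    rw [Finset.mem_filter, hmem'] at hu
    rw [Finset.mem_filter, hmem, hh]
    refine ⟨?_, hu.2⟩
    simpa [dw_dw] using hd _ _ hu.1
  · intro u hu
    rw [Finset.mem_filter, hmem] at hu
    rw [Finset.mem_filter, hmem', ← hh, dw_dw]
    exact ⟨hd _ _ hu.1, hu.2⟩
  · intros; exact dw_dw _
  · intros; exact dw_dw _
  · intro u hu
    rw [Finset.mem_filter] at hu
    rw [duality u hu.2]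
    simp [dw]

/-! The dual sequence -/

theorem unPartial_aux (P : ℕ → Bool) (k j b : ℕ) (h0 : k = 0 → j = 0)
    (hP : 1 ≤ k → P (b + j + k) = true) :
    (∀ a ∈ List.zipWith (· - ·) ((List.range' (b + j + 1) k).filter P)
        (b :: (List.range' (b + j + 1) k).filter P), 1 ≤ a) ∧
    word (List.zipWith (· - ·) ((List.range' (b + j + 1) k).filter P)
        (b :: (List.range' (b + j + 1) k).filter P)) =
      List.replicate j false ++ (List.range' (b + j + 1) k).map P := by
  induction k generalizing j b with
  | zero => simp [h0 rfl, word]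
  | succ k ih =>
    rw [List.range'_succ]
    by_cases hp : P (b + j + 1) = true
    · rw [List.filter_cons_of_pos hp, List.zipWith_cons_cons, word_cons]
      have := ih 0 (b + j + 1) (fun _ => rfl) (fun h => by
        have := hP (by omega)
        rwa [show b + j + 1 + 0 + k = b + j + (k + 1) by omega])
      simp only [add_zero] at this
      rw [this.2]
      constructor
      · intro a ha
        rcases List.mem_cons.1 ha with rfl | ha
        · omega
        · exact this.1 a ha
      · rw [show b + j + 1 - b - 1 = j by omega]
        simp [hp]
    · rw [List.filter_cons_of_neg hp]
      have hk : k ≠ 0 := by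
        rintro rfl
        exact hp (hP (by omega))
      have := ih (j + 1) b (fun h => absurd h hk) (fun h => by
        have := hP (by omega)
        rwa [show b + (j + 1) + k = b + j + (k + 1) by omega])
      rw [show b + (j + 1) + 1 = b + j + 1 + 1 by omega] at this
      refine ⟨this.1, ?_⟩
      rw [this.2]
      simp at hp
      simp [hp, List.replicate_succ']

theorem partialSums_cons (a : ℕ) (s : List ℕ) :
    partialSums (a :: s) = a :: (partialSums s).map (a + ·) := by
  unfold partialSums
  rw [List.length_cons, List.range_succ_eq_map]
  simp [Function.comp_def]

theorem mem_partialSums_le (s : List ℕ) (x : ℕ) (h : x ∈ partialSums s) : x ≤ s.sum := by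
  induction s generalizing x with
  | nil => simp [partialSums] at h
  | cons a s ih =>
    rw [partialSums_cons] at h
    rw [List.sum_cons]
    rcases List.mem_cons.1 h with rfl | h
    · omega
    · obtain ⟨y, hy, rfl⟩ := List.mem_map.1 h
      have := ih y hy
      omega

theorem word_eq_map (s : List ℕ) (hs : ∀ b ∈ s, 1 ≤ b) :
    word s = (List.range' 1 s.sum).map (fun m => decide (m ∈ partialSums s)) := by
  induction s with
  | nil => simp [word]
  | cons a s ih =>
    have ha := hs a (by simp)
    obtain ⟨c, rfl⟩ : ∃ c, a = c + 1 := ⟨a - 1, by omega⟩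
    rw [word_cons, ih (fun b hb => hs b (by simp [hb])), List.sum_cons, partialSums_cons]
    rw [show c + 1 + s.sum = c + (1 + s.sum) by omega, ← List.range'_append_1 (m := c),
      List.map_append]
    congr 1
    · symm
      rw [List.eq_replicate_iff]
      refine ⟨by simp, ?_⟩
      intro b hb
      obtain ⟨m, hm, rfl⟩ := List.mem_map.1 hb
      rw [List.mem_range'_1] at hm
      rw [decide_eq_false_iff_not]
      simp only [List.mem_cons, List.mem_map]
      rintro (h | ⟨y, _, h⟩) <;> omega
    · rw [← List.range'_append_1 (m := 1) (n := s.sum), List.map_append, ← List.singleton_append]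
      congr 1
      · simp [add_comm]
      · rw [show 1 + c + 1 = (c + 1) + 1 by omega, ← List.map_add_range' (a := c + 1), List.map_map]
        refine List.map_congr_left fun m hm => ?_
        rw [List.mem_range'_1] at hm
        simp only [Function.comp]
        rw [decide_eq_decide]
        simp only [List.mem_cons, List.mem_map]
        constructor
        · intro h; right; exact ⟨m, h, rfl⟩
        · rintro (h | ⟨y, hy, h⟩)
          · omega
          · have : y = m := by omega
            rwa [← this]

theorem dual_word (s : List ℕ) (hs : ∀ b ∈ s, 1 ≤ b) (hadm : ∃ a t, s = a :: t ∧ 2 ≤ a) :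
    (∀ b ∈ dualSeq s, 1 ≤ b) ∧ word (dualSeq s) = dw (word s) := by
  have hr : (List.range s.sum).map (· + 1) = List.range' 1 s.sum := by
    rw [List.range_eq_range']
    have := List.map_add_range' (a := 1) 0 s.sum 1
    simpa [add_comm] using this
  set r := (partialSums s).reverse.map fun a => s.sum + 1 - a with hrdef
  set P : ℕ → Bool := fun m => decide (m ∉ r) with hPdef
  have hmem : ∀ m, 1 ≤ m → m ≤ s.sum → (m ∈ r ↔ s.sum + 1 - m ∈ partialSums s) := by
    intro m h1 h2
    simp only [hrdef, List.mem_map, List.mem_reverse]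
    constructor
    · rintro ⟨a, ha, rfl⟩
      have := mem_partialSums_le s a ha
      rwa [show s.sum + 1 - (s.sum + 1 - a) = a by omega]
    · intro h
      exact ⟨_, h, by omega⟩
  have hd : dualSeq s = List.zipWith (· - ·) ((List.range' (0 + 0 + 1) s.sum).filter P)
        (0 :: (List.range' (0 + 0 + 1) s.sum).filter P) := by
    unfold dualSeq unPartial
    simp only [hr]
    rfl
  have hlast : 1 ≤ s.sum → P (0 + 0 + s.sum) = true := by
    intro h
    simp only [hPdef, decide_eq_true_eq, zero_add]
    rw [hmem _ h le_rfl, show s.sum + 1 - s.sum = 1 by omega]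
    obtain ⟨a, t, rfl, ha⟩ := hadm
    rw [partialSums_cons]
    simp only [List.mem_cons, List.mem_map]
    rintro (h | ⟨y, _, h⟩) <;> omega
  have := unPartial_aux P s.sum 0 0 (fun _ => rfl) hlast
  rw [← hd] at this
  refine ⟨this.1, ?_⟩
  rw [this.2, word_eq_map s hs]
  unfold dw
  simp only [List.replicate_zero, List.nil_append, zero_add]
  refine List.ext_getElem (by simp) ?_
  intro i h1 h2
  simp at h1
  simp only [List.getElem_map, List.getElem_reverse, List.getElem_range', hPdef, List.length_map,
    List.length_range']
  have := hmem (1 + 1 * i) (by omega) (by omega)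
  rw [show s.sum + 1 - (1 + 1 * i) = 1 + 1 * (s.sum - 1 - i) by omega] at this
  simp only [decide_not, this]

end CycSum

theorem cyclic_sum_theorem_form2 (s : List ℕ)
    (hpos : ∀ a ∈ s, 1 ≤ a) (hadm : ∃ a t, s = a :: t ∧ 2 ≤ a) :
    ∑ p ∈ cycClass s, mzv ((p.headI + 1) :: p.tail) =
      ∑ q ∈ cycClass (dualSeq s), mzv ((q.headI + 1) :: q.tail) := by
  have hne : s ≠ [] := by
    obtain ⟨a, t, rfl, _⟩ := hadm; simp
  have hwne := CycSum.word_ne_nil s hne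
  obtain ⟨hd1, hd2⟩ := CycSum.dual_word s hpos hadm
  have hdne : dualSeq s ≠ [] := by
    intro h
    rw [h] at hd2
    have : CycSum.dw (CycSum.word s) = [] := hd2.symm
    simp [CycSum.dw] at this
    exact hwne this
  rw [CycSum.sum_cyc s hpos hne, CycSum.sum_cyc _ hd1 hdne, hd2, CycSum.dual_words _ hwne,
    CycSum.cyc_words]
  · obtain ⟨a, t, rfl, ha⟩ := hadm
    rw [CycSum.word_cons]
    obtain ⟨b, rfl⟩ : ∃ b, a = b + 2 := ⟨a - 2, by omega⟩
    simp [List.replicate_succ]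
  · exact List.mem_of_getLast? (CycSum.word_last' s hne)
end

section
/- (Sum theorem; Corollary 2.4.) For all integers l, n with 1 ≤ l < n, the sum of ζ(k₁,…,k_l) over all admissible sequences (k₁,…,k_l) of positive integers with k₁ ≥ 2 and k₁+⋯+k_l = n equals ζ(n). In particular this sum is independent of l. -/
open scoped ENNReal

/-- The connector. -/
noncomputable def conn (x : ℝ) (n p : ℕ) : ℝ :=
  ∏ j ∈ Finset.range n, (((j : ℝ) + 1 - x) / ((j : ℝ) + 1 + p - x))

lemma conn_succ (x : ℝ) (n p : ℕ) :
    conn x (n + 1) p = conn x n p * (((n : ℝ) + 1 - x) / ((n : ℝ) + 1 + p - x)) := by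
  rw [conn, Finset.prod_range_succ, conn]

lemma conn_nonneg {x : ℝ} (hx : x < 1) (n p : ℕ) : 0 ≤ conn x n p := by
  unfold conn
  refine Finset.prod_nonneg fun j _ => div_nonneg ?_ ?_
  · have : (0 : ℝ) ≤ j := by positivity
    linarith
  · have : (0 : ℝ) ≤ j := by positivity
    have : (0 : ℝ) ≤ p := by positivity
    linarith

lemma conn_zero_right {x : ℝ} (hx : x < 1) (n : ℕ) : conn x n 0 = 1 := by
  induction n with
  | zero => simp [conn]
  | succ n ih =>
    rw [conn_succ, ih]
    have : (0 : ℝ) ≤ n := by positivity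
    have : (n : ℝ) + 1 - x ≠ 0 := by linarith
    simp [this]

lemma conn_succ_right {x : ℝ} (hx : x < 1) (n p : ℕ) :
    conn x n (p + 1) = conn x n p * (((p : ℝ) + 1 - x) / ((p : ℝ) + 1 + n - x)) := by
  induction n with
  | zero =>
    have : (0 : ℝ) ≤ p := by positivity
    have : (p : ℝ) + 1 - x ≠ 0 := by linarith
    simp [conn, this]
  | succ n ih =>
    rw [conn_succ, conn_succ, ih]
    have h1 : (0 : ℝ) ≤ n := by positivity
    have h2 : (0 : ℝ) ≤ p := by positivity
    have h3 : (p : ℝ) + 1 + n - x ≠ 0 := by linarith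
    have h4 : (n : ℝ) + 1 + p - x ≠ 0 := by linarith
    have h5 : (p : ℝ) + 1 + (n + 1) - x ≠ 0 := by linarith
    have h6 : (n : ℝ) + 1 + (p + 1) - x ≠ 0 := by linarith
    push_cast
    field_simp
    ring

lemma conn_symm {x : ℝ} (hx : x < 1) (n p : ℕ) : conn x n p = conn x p n := by
  induction p with
  | zero => rw [conn_zero_right hx]; simp [conn]
  | succ p ih => rw [conn_succ_right hx, ih, conn_succ]

lemma conn_le {x : ℝ} (hx : x < 1) (n p : ℕ) (hp : 1 ≤ p) :
    conn x n p ≤ (1 - x) / ((n : ℝ) + 1 - x) := by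
  induction n with
  | zero =>
    have : 1 - x ≠ 0 := by linarith
    simp [conn, this]
  | succ n ih =>
    rw [conn_succ]
    have h1 : (0 : ℝ) ≤ n := by positivity
    have h2 : (1 : ℝ) ≤ p := by exact_mod_cast hp
    have h3 : 0 < (n : ℝ) + 1 - x := by linarith
    have h4 : 0 < (n : ℝ) + 1 + 1 - x := by linarith
    calc _ ≤ (1 - x) / ((n : ℝ) + 1 - x) * (((n : ℝ) + 1 - x) / ((n : ℝ) + 1 + 1 - x)) := by
          have : 0 ≤ 1 - x := by linarith
          gcongr
          exact div_nonneg (by linarith) (by linarith)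
      _ = _ := by
          push_cast
          field_simp

lemma conn_hasSum {x : ℝ} (hx : x < 1) (a p : ℕ) (hp : 1 ≤ p) :
    HasSum (fun i : ℕ => conn x (a + 1 + i) p * (1 / (((a + 1 + i : ℕ) : ℝ) - x)))
      (conn x a p / p) := by
  have hp' : (1 : ℝ) ≤ p := by exact_mod_cast hp
  have key : ∀ N : ℕ, ∑ i ∈ Finset.range N,
      conn x (a + 1 + i) p * (1 / (((a + 1 + i : ℕ) : ℝ) - x))
      = conn x a p / p - conn x (a + N) p / p := by
    intro N
    induction N with
    | zero => simp
    | succ N ih =>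
      rw [Finset.sum_range_succ, ih, show a + 1 + N = a + N + 1 by ring, ← add_assoc, conn_succ]
      have h1 : (0 : ℝ) ≤ (a + N : ℕ) := by positivity
      generalize a + N = m at *
      have h3 : (m : ℝ) + 1 - x ≠ 0 := by linarith
      have h4 : (m : ℝ) + 1 + p - x ≠ 0 := by linarith
      push_cast
      field_simp
      ring
  rw [hasSum_iff_tendsto_nat_of_nonneg]
  · simp_rw [key]
    have h0 : Filter.Tendsto (fun N : ℕ => conn x N p) Filter.atTop (nhds 0) := by
      refine squeeze_zero (fun N => conn_nonneg hx _ _) (fun N => conn_le hx _ _ hp) ?_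
      refine Filter.Tendsto.div_atTop tendsto_const_nhds ?_
      have := tendsto_natCast_atTop_atTop (R := ℝ)
      have := Filter.tendsto_atTop_add_const_right Filter.atTop (1 - x) this
      refine this.congr fun n => by ring
    have h1 : Filter.Tendsto (fun N : ℕ => conn x (a + N) p) Filter.atTop (nhds 0) := by
      have := (Filter.tendsto_add_atTop_iff_nat a).2 h0
      refine this.congr fun n => by rw [add_comm]
    have := (h1.div_const (p : ℝ)).const_sub (conn x a p / p)
    simpa using this
  · intro i
    refine mul_nonneg (conn_nonneg hx _ _) (div_nonneg zero_le_one ?_)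
    push_cast
    have h1 : (0 : ℝ) ≤ (a : ℝ) := by positivity
    have h1 : (0 : ℝ) ≤ (i : ℝ) := by positivity
    linarith

lemma tsum_gt (f : ℕ → ℝ≥0∞) (a : ℕ) :
    ∑' b, (if a < b then f b else 0) = ∑' i, f (a + 1 + i) := by
  rw [← Summable.sum_add_tsum_nat_add' (f := fun b => if a < b then f b else 0) (k := a + 1)
    ENNReal.summable]
  rw [Finset.sum_eq_zero, zero_add]
  · refine tsum_congr fun i => ?_
    rw [if_pos (by omega), add_comm]
  · intro i hi
    rw [if_neg]
    simp at hi
    omega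

/-- the weight `1/(n-x)` -/
noncomputable def wt (x : ℝ) (n : ℕ) : ℝ≥0∞ := ENNReal.ofReal (1 / ((n : ℝ) - x))

lemma conn_tsum {x : ℝ} (hx : x < 1) (a p : ℕ) (hp : 1 ≤ p) :
    ∑' b, (if a < b then ENNReal.ofReal (conn x b p) * wt x b else 0)
      = ENNReal.ofReal (conn x a p) * ENNReal.ofReal (1 / p) := by
  rw [tsum_gt]
  have h := conn_hasSum hx a p hp
  rw [← ENNReal.ofReal_mul (conn_nonneg hx _ _), mul_one_div, ← h.tsum_eq,
    ENNReal.ofReal_tsum_of_nonneg _ h.summable]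
  · refine tsum_congr fun i => ?_
    rw [wt, ENNReal.ofReal_mul (conn_nonneg hx _ _)]
  · intro i
    refine mul_nonneg (conn_nonneg hx _ _) (div_nonneg zero_le_one ?_)
    push_cast
    have h1 : (0 : ℝ) ≤ (a : ℝ) := by positivity
    have h1 : (0 : ℝ) ≤ (i : ℝ) := by positivity
    linarith

/-- strictly decreasing chains above `a` -/
def Chain (a : ℕ) {l : ℕ} (n : Fin l → ℕ) : Prop :=
  (∀ i j : Fin l, i < j → n j < n i) ∧ ∀ i, a + 1 ≤ n i

lemma chain_snoc (a : ℕ) {l : ℕ} (b : ℕ) (m : Fin (l + 1) → ℕ) :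
    Chain a (Fin.snoc (α := fun _ => ℕ) m b : Fin (l + 1 + 1) → ℕ) ↔ a < b ∧ Chain b m := by
  unfold Chain
  constructor
  · rintro ⟨h1, h2⟩
    refine ⟨by simpa using h2 (Fin.last _), fun i j hij => ?_, fun i => ?_⟩
    · simpa using h1 i.castSucc j.castSucc (by simpa using hij)
    · simpa using h1 i.castSucc (Fin.last _) (Fin.castSucc_lt_last i)
  · rintro ⟨hab, h1, h2⟩
    constructor
    · intro i j
      refine Fin.lastCases ?_ (fun j => ?_) j
      · refine Fin.lastCases ?_ (fun i => ?_) i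
        · simp
        · intro _
          simpa using h2 i
      · refine Fin.lastCases ?_ (fun i => ?_) i
        · intro h
          exact absurd h (not_lt.2 (Fin.le_last _))
        · intro h
          simpa using h1 i j (by simpa using h)
    · intro i
      refine Fin.lastCases ?_ (fun i => ?_) i
      · simpa using hab
      · have := h2 i
        simp; omega

open Classical in
lemma chain_tsum {x : ℝ} (hx : x < 1) (p : ℕ) (hp : 1 ≤ p) (l : ℕ) : ∀ a : ℕ,
    ∑' n : Fin (l + 1) → ℕ, (if Chain a n then
      ENNReal.ofReal (conn x (n 0) p) * ∏ i, wt x (n i) else 0)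
      = ENNReal.ofReal (conn x a p) * ENNReal.ofReal (1 / p) ^ (l + 1) := by
  induction l with
  | zero =>
    intro a
    rw [show ENNReal.ofReal (1 / (p : ℝ)) ^ (0 + 1) = ENNReal.ofReal (1 / (p : ℝ)) from pow_one _,
      ← conn_tsum hx a p hp]
    change ∑' n : Fin 1 → ℕ, _ = _
    rw [← (Equiv.funUnique (Fin 1) ℕ).symm.tsum_eq]
    refine tsum_congr fun b => ?_
    simp [Chain, Nat.succ_le_iff]
  | succ l ih =>
    intro a
    rw [← (Fin.snocEquiv (fun _ : Fin (l + 1 + 1) => ℕ)).tsum_eq, ENNReal.tsum_prod']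
    rw [pow_succ', ← mul_assoc, ← conn_tsum hx a p hp, ← ENNReal.tsum_mul_right]
    refine tsum_congr fun b => ?_
    by_cases hab : a < b
    · rw [if_pos hab, mul_right_comm, ← ih b, ← ENNReal.tsum_mul_right]
      refine tsum_congr fun m => ?_
      change (if Chain a (Fin.snoc (α := fun _ => ℕ) m b : Fin (l + 1 + 1) → ℕ) then _ else _) = _
      rw [chain_snoc]
      by_cases hm : Chain b m
      · rw [if_pos ⟨hab, hm⟩, if_pos hm, Fin.prod_univ_castSucc, ← mul_assoc]
        have h0 : (Fin.snocEquiv (fun _ : Fin (l + 1 + 1) => ℕ)) (b, m) 0 = m 0 := by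
          exact Fin.snoc_castSucc (α := fun _ => ℕ) b m 0
        rw [h0]
        simp [Fin.snocEquiv]
      · rw [if_neg (fun h => hm h.2), if_neg hm, zero_mul]
    · rw [if_neg hab, zero_mul]
      refine ENNReal.tsum_eq_zero.2 fun m => ?_
      change (if Chain a (Fin.snoc (α := fun _ => ℕ) m b : Fin (l + 1 + 1) → ℕ) then _ else _) = _
      rw [chain_snoc, if_neg (fun h => hab h.1)]

open Classical in
lemma gen_eq {x : ℝ} (hx : x < 1) (l : ℕ) :
    ∑' n : Fin (l + 1) → ℕ, (if Chain 0 n then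
      ENNReal.ofReal (1 / (n 0 : ℕ)) * ∏ i, wt x (n i) else 0)
      = ∑' p : ℕ, (if 0 < p then ENNReal.ofReal (1 / p) ^ (l + 1) * wt x p else 0) := by
  have h1 : ∀ n : Fin (l + 1) → ℕ, (if Chain 0 n then
      ENNReal.ofReal (1 / (n 0 : ℕ)) * ∏ i, wt x (n i) else 0) =
      ∑' p : ℕ, (if 0 < p then wt x p * (if Chain 0 n then
        ENNReal.ofReal (conn x (n 0) p) * ∏ i, wt x (n i) else 0) else 0) := by
    intro n
    by_cases hn : Chain 0 n
    · simp only [if_pos hn]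
      have := conn_tsum hx 0 (n 0) (by simpa using hn.2 0)
      rw [show conn x 0 (n 0) = 1 by simp [conn]] at this
      rw [ENNReal.ofReal_one, one_mul] at this
      rw [← this, ← ENNReal.tsum_mul_right]
      refine tsum_congr fun p => ?_
      split_ifs
      · rw [conn_symm hx]; ring
      · simp
    · simp [hn]
  simp_rw [h1]
  rw [ENNReal.tsum_comm]
  refine tsum_congr fun p => ?_
  split_ifs with hp
  · rw [ENNReal.tsum_mul_left, chain_tsum hx p hp l 0]
    simp [conn, mul_comm]
  · simp

lemma prod_tsum_fin (l : ℕ) : ∀ f : Fin l → ℕ → ℝ≥0∞,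
    ∏ i, ∑' e, f i e = ∑' e : Fin l → ℕ, ∏ i, f i (e i) := by
  induction l with
  | zero => intro f; simp
  | succ l ih =>
    intro f
    rw [Fin.prod_univ_succ, ih, ← (Fin.consEquiv (fun _ : Fin (l + 1) => ℕ)).tsum_eq,
      ENNReal.tsum_prod', ← ENNReal.tsum_mul_right]
    refine tsum_congr fun a => ?_
    rw [← ENNReal.tsum_mul_left]
    refine tsum_congr fun e => ?_
    rw [Fin.prod_univ_succ]
    simp [Fin.consEquiv]

lemma tsum_antidiag (l : ℕ) (f : (Fin l → ℕ) → ℝ≥0∞) :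
    ∑' e : Fin l → ℕ, f e = ∑' N, ∑ e ∈ Finset.Nat.antidiagonalTuple l N, f e := by
  rw [← (Finset.Nat.sigmaAntidiagonalTupleEquivTuple l).tsum_eq, ENNReal.tsum_sigma']
  refine tsum_congr fun N => ?_
  rw [← Finset.tsum_subtype]
  rfl

/-- `1 / n^k` -/
noncomputable def ip (n k : ℕ) : ℝ≥0∞ := ENNReal.ofReal (((n : ℝ) ^ k)⁻¹)

lemma ip_add (n j k : ℕ) : ip n (j + k) = ip n j * ip n k := by
  rw [ip, ip, ip, ← ENNReal.ofReal_mul (by positivity), pow_add, mul_inv]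

lemma wt_expand {x : ℝ} (h0 : 0 ≤ x) (hx : x < 1) (n : ℕ) (hn : 1 ≤ n) :
    wt x n = ∑' e : ℕ, ENNReal.ofReal x ^ e * ip n (e + 1) := by
  have hn' : (1 : ℝ) ≤ n := by exact_mod_cast hn
  have hr0 : 0 ≤ x / n := by positivity
  have hr1 : x / n < 1 := by rw [div_lt_one (by linarith)]; linarith
  have hs := (hasSum_geometric_of_lt_one hr0 hr1).mul_right ((n : ℝ)⁻¹)
  have hv : (1 - x / n)⁻¹ * (n : ℝ)⁻¹ = 1 / (n - x) := by
    have : (n : ℝ) - x ≠ 0 := by linarith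
    have : (n : ℝ) ≠ 0 := by linarith
    rw [← mul_inv, one_div]
    congr 1
    field_simp
  rw [wt, ← hv, ← hs.tsum_eq, ENNReal.ofReal_tsum_of_nonneg (fun e => by positivity) hs.summable]
  refine tsum_congr fun e => ?_
  rw [ip, ← ENNReal.ofReal_pow h0, ← ENNReal.ofReal_mul (by positivity)]
  congr 1
  rw [div_pow, pow_succ, mul_inv]
  ring

open Classical in
/-- extended MZV -/
noncomputable def ez {l : ℕ} (k : Fin l → ℕ) : ℝ≥0∞ :=
  ∑' n : Fin l → ℕ, if Chain 0 n then ∏ i, ip (n i) (k i) else 0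

/-- shift of exponents -/
def shf {l : ℕ} (e : Fin (l + 1) → ℕ) : Fin (l + 1) → ℕ := fun i => e i + 1 + if i = 0 then 1 else 0

open Classical in
lemma gen_left {x : ℝ} (h0 : 0 ≤ x) (hx : x < 1) (l : ℕ) :
    ∑' n : Fin (l + 1) → ℕ, (if Chain 0 n then
      ENNReal.ofReal (1 / (n 0 : ℕ)) * ∏ i, wt x (n i) else 0)
    = ∑' N, (∑ e ∈ Finset.Nat.antidiagonalTuple (l + 1) N, ez (shf e)) * ENNReal.ofReal x ^ N := by
  have h1 : ∀ n : Fin (l + 1) → ℕ, (if Chain 0 n then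
      ENNReal.ofReal (1 / (n 0 : ℕ)) * ∏ i, wt x (n i) else 0) =
      ∑' e : Fin (l + 1) → ℕ, ENNReal.ofReal x ^ (∑ i, e i) *
        (if Chain 0 n then ∏ i, ip (n i) (shf e i) else 0) := by
    intro n
    by_cases hn : Chain 0 n
    · simp only [if_pos hn]
      have hw : ∀ i, wt x (n i) = ∑' e : ℕ, ENNReal.ofReal x ^ e * ip (n i) (e + 1) :=
        fun i => wt_expand h0 hx _ (by simpa using hn.2 i)
      simp_rw [hw]
      rw [prod_tsum_fin, ← ENNReal.tsum_mul_left]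
      refine tsum_congr fun e => ?_
      rw [Finset.prod_mul_distrib, Finset.prod_pow_eq_pow_sum]
      simp only [shf, ip_add _ (_ + 1)]
      rw [Finset.prod_mul_distrib]
      have : ∏ i : Fin (l + 1), ip (n i) (if i = 0 then 1 else 0) = ENNReal.ofReal (1 / (n 0 : ℕ)) := by
        rw [Fin.prod_univ_succ]
        simp [ip]
      rw [this]
      ring
    · simp [hn]
  simp_rw [h1]
  rw [ENNReal.tsum_comm]
  simp_rw [ENNReal.tsum_mul_left]
  rw [tsum_antidiag]
  refine tsum_congr fun N => ?_
  rw [Finset.sum_mul]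
  refine Finset.sum_congr rfl fun e he => ?_
  rw [Finset.Nat.mem_antidiagonalTuple.1 he, mul_comm, ez]

/-- extended zeta value -/
noncomputable def ez1 (k : ℕ) : ℝ≥0∞ := ∑' p : ℕ, if 0 < p then ip p k else 0

lemma gen_right {x : ℝ} (h0 : 0 ≤ x) (hx : x < 1) (l : ℕ) :
    ∑' p : ℕ, (if 0 < p then ENNReal.ofReal (1 / p) ^ (l + 1) * wt x p else 0)
    = ∑' N, ez1 (N + l + 2) * ENNReal.ofReal x ^ N := by
  simp only [ez1]
  simp_rw [← ENNReal.tsum_mul_right]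
  rw [ENNReal.tsum_comm]
  refine tsum_congr fun p => ?_
  by_cases hp : 0 < p
  · simp only [if_pos hp]
    rw [wt_expand h0 hx p hp, ← ENNReal.tsum_mul_left]
    refine tsum_congr fun N => ?_
    have : ENNReal.ofReal (1 / (p : ℝ)) ^ (l + 1) = ip p (l + 1) := by
      rw [ip, ← ENNReal.ofReal_pow (by positivity)]; simp
    rw [this, show N + l + 2 = (l + 1) + (N + 1) by ring, ip_add p (l + 1)]
    ring
  · simp [hp]

lemma ps_unique (N : ℕ) : ∀ A B : ℕ → ℝ≥0∞,
    (∀ x : ℝ, 0 < x → x ≤ 1 / 2 →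
      ∑' k, A k * ENNReal.ofReal x ^ k = ∑' k, B k * ENNReal.ofReal x ^ k) →
    ∑' k, B k * ENNReal.ofReal (1 / 2) ^ k ≠ ∞ → A N = B N := by
  have split : ∀ (A : ℕ → ℝ≥0∞) (x : ℝ), ∑' k, A k * ENNReal.ofReal x ^ k
      = A 0 + ENNReal.ofReal x * ∑' k, A (k + 1) * ENNReal.ofReal x ^ k := by
    intro A x
    rw [tsum_eq_zero_add' ENNReal.summable, ← ENNReal.tsum_mul_left]
    simp only [pow_zero, mul_one]
    congr 1
    refine tsum_congr fun k => ?_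
    rw [pow_succ]; ring
  have half0 : ENNReal.ofReal (1 / 2) ≠ 0 := by simp
  have tail : ∀ A : ℕ → ℝ≥0∞, ∑' k, A k * ENNReal.ofReal (1 / 2) ^ k ≠ ∞ →
      ∑' k, A (k + 1) * ENNReal.ofReal (1 / 2) ^ k ≠ ∞ := by
    intro A hA h
    rw [split, h, ENNReal.mul_top half0] at hA
    simp at hA
  have le : ∀ A B : ℕ → ℝ≥0∞, (∀ x : ℝ, 0 < x → x ≤ 1 / 2 →
      ∑' k, A k * ENNReal.ofReal x ^ k = ∑' k, B k * ENNReal.ofReal x ^ k) →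
      ∑' k, B k * ENNReal.ofReal (1 / 2) ^ k ≠ ∞ → A 0 ≤ B 0 := by
    intro A B h hB
    set M := ∑' k, B (k + 1) * ENNReal.ofReal (1 / 2) ^ k with hM
    have hMt : M ≠ ∞ := tail B hB
    have hb : ∀ x : ℝ, 0 < x → x ≤ 1 / 2 → A 0 ≤ B 0 + ENNReal.ofReal x * M := by
      intro x hx hx'
      calc A 0 ≤ ∑' k, A k * ENNReal.ofReal x ^ k := by rw [split]; exact le_self_add
        _ = B 0 + ENNReal.ofReal x * ∑' k, B (k + 1) * ENNReal.ofReal x ^ k := by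
            rw [h x hx hx', split]
        _ ≤ _ := by
            rw [hM]
            gcongr
    have ht : Filter.Tendsto (fun x : ℝ => B 0 + ENNReal.ofReal x * M)
        (nhdsWithin 0 (Set.Ioi 0)) (nhds (B 0 + ENNReal.ofReal 0 * M)) := by
      refine Filter.Tendsto.mono_left ?_ nhdsWithin_le_nhds
      refine tendsto_const_nhds.add ?_
      exact ENNReal.Tendsto.mul_const (ENNReal.continuous_ofReal.tendsto 0) (Or.inr hMt)
    rw [ENNReal.ofReal_zero, zero_mul, add_zero] at ht
    refine ge_of_tendsto ht ?_
    filter_upwards [Ioc_mem_nhdsGT (show (0 : ℝ) < 1 / 2 by norm_num)] with x hx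
    exact hb x hx.1 hx.2
  induction N with
  | zero =>
    intro A B h hB
    refine _root_.le_antisymm (le A B h hB) (le B A (fun x h1 h2 => (h x h1 h2).symm) ?_)
    rw [h _ (by norm_num) le_rfl]
    exact hB
  | succ N ih =>
    intro A B h hB
    have h0 : A 0 = B 0 := by
      refine _root_.le_antisymm (le A B h hB) (le B A (fun x h1 h2 => (h x h1 h2).symm) ?_)
      rw [h _ (by norm_num) le_rfl]
      exact hB
    refine ih (fun k => A (k + 1)) (fun k => B (k + 1)) ?_ (tail B hB)
    intro x hx hx'
    have := h x hx hx'
    have hB0 : B 0 ≠ ∞ := by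
      intro hh
      rw [split, hh] at hB
      simp at hB
    rw [split, split B, h0, ENNReal.add_right_inj hB0] at this
    exact (ENNReal.mul_right_inj (by simpa using hx) ENNReal.ofReal_ne_top).1 this

lemma ez1_le (k : ℕ) : ez1 (k + 2) ≤ ez1 2 := by
  refine ENNReal.tsum_le_tsum fun p => ?_
  split_ifs with hp
  · rw [add_comm, ip_add]
    refine mul_le_of_le_one_right' ?_
    rw [ip]
    refine ENNReal.ofReal_le_one.2 (inv_le_one_of_one_le₀ (one_le_pow₀ ?_))
    exact_mod_cast hp
  · exact le_rfl

lemma ez1_two : ez1 2 ≠ ∞ := by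
  have hs : Summable (fun p : ℕ => ((p : ℝ) ^ 2)⁻¹) := Real.summable_nat_pow_inv.2 (by norm_num)
  refine ne_top_of_le_ne_top hs.tsum_ofReal_ne_top ?_
  refine ENNReal.tsum_le_tsum fun p => ?_
  split_ifs
  · exact le_rfl
  · exact zero_le

lemma main_e (l N : ℕ) :
    ∑ e ∈ Finset.Nat.antidiagonalTuple (l + 1) N, ez (shf e) = ez1 (N + l + 2) := by
  refine ps_unique N (fun N => ∑ e ∈ Finset.Nat.antidiagonalTuple (l + 1) N, ez (shf e))
    (fun N => ez1 (N + l + 2)) ?_ ?_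
  · intro x h0 hx
    rw [← gen_left h0.le (by linarith), ← gen_right h0.le (by linarith), gen_eq (by linarith)]
  · have : ∑' k : ℕ, ez1 2 * ENNReal.ofReal (1 / 2) ^ k ≠ ∞ := by
      rw [ENNReal.tsum_mul_left, ENNReal.tsum_geometric]
      refine ENNReal.mul_ne_top ez1_two ?_
      rw [ENNReal.inv_ne_top]
      refine (tsub_pos_of_lt ?_).ne'
      rw [ENNReal.ofReal_lt_one]
      norm_num
    refine ne_top_of_le_ne_top this (ENNReal.tsum_le_tsum fun k => ?_)
    gcongr
    exact ez1_le _

lemma mzv_eq (L : List ℕ) : mzv L = (ez L.get).toReal := by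
  classical
  rw [mzv, ez, ENNReal.tsum_toReal_eq]
  · refine tsum_congr fun n => ?_
    by_cases h : Chain 0 n
    · rw [if_pos h, if_pos (by simpa [Chain] using h), ENNReal.toReal_prod]
      refine Finset.prod_congr rfl fun i _ => ?_
      rw [ip, ENNReal.toReal_ofReal (by positivity)]
    · rw [if_neg h, if_neg (by simpa [Chain] using h)]
      rfl
  · intro n
    split_ifs
    · exact ENNReal.prod_ne_top fun i _ => ENNReal.ofReal_ne_top
    · exact ENNReal.zero_ne_top

lemma ez_cast {l m : ℕ} (h : m = l) (k : Fin l → ℕ) : ez (fun i : Fin m => k (i.cast h)) = ez k := by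
  subst h
  rfl

lemma mzv_ofFn {l : ℕ} (k : Fin l → ℕ) : mzv (List.ofFn k) = (ez k).toReal := by
  rw [mzv_eq, ← ez_cast (List.length_ofFn (f := k)) k]
  congr 2
  funext i
  simp
  rfl

lemma mzv_single (n : ℕ) : mzv [n] = (ez1 n).toReal := by
  classical
  rw [mzv_eq, ez, ez1]
  congr 1
  change ∑' m : Fin 1 → ℕ, _ = _
  rw [← (Equiv.funUnique (Fin 1) ℕ).symm.tsum_eq]
  refine tsum_congr fun b => ?_
  simp [Chain, Nat.succ_le_iff]

/-- **Sum theorem.**  For `1 ≤ l < n`, the sum of `ζ(k₁,…,k_l)` over all admissible sequences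
`(k₁,…,k_l)` of positive integers with `k₁ ≥ 2` and `k₁+⋯+k_l = n` equals `ζ(n)`. -/
theorem sum_theorem (l n : ℕ) (hl : 1 ≤ l) (hn : l < n) :
    ∑ k ∈ (Finset.Nat.antidiagonalTuple l n).filter
        (fun k => (∀ i, 1 ≤ k i) ∧ 2 ≤ k ⟨0, hl⟩),
      mzv (List.ofFn k) = mzv [n] := by
  obtain ⟨l, rfl⟩ : ∃ m, l = m + 1 := ⟨l - 1, by omega⟩
  obtain ⟨N, rfl⟩ : ∃ N, n = N + l + 2 := ⟨n - l - 2, by omega⟩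
  have hsum : ∀ e : Fin (l + 1) → ℕ, ∑ i, shf e i = ∑ i, e i + l + 2 := by
    intro e
    simp only [shf, Finset.sum_add_distrib]
    simp
    ring
  have hfin : ∀ e ∈ Finset.Nat.antidiagonalTuple (l + 1) N, ez (shf e) ≠ ∞ := by
    refine ENNReal.sum_ne_top.1 ?_
    rw [main_e]
    exact ne_top_of_le_ne_top ez1_two (ez1_le _)
  rw [mzv_single, ← main_e, ENNReal.toReal_sum hfin]
  symm
  refine Finset.sum_bij (fun e _ => shf e) ?_ ?_ ?_ ?_
  · intro e he
    rw [Finset.Nat.mem_antidiagonalTuple] at he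
    rw [Finset.mem_filter, Finset.Nat.mem_antidiagonalTuple, hsum, he]
    refine ⟨rfl, fun i => ?_, ?_⟩
    · simp only [shf]; omega
    · change 2 ≤ shf e 0
      simp [shf]
  · intro e _ e' _ h
    funext i
    have := congrFun h i
    simpa [shf] using this
  · intro k hk
    rw [Finset.mem_filter, Finset.Nat.mem_antidiagonalTuple] at hk
    obtain ⟨hs, h1, h2⟩ := hk
    have hk : shf (fun i => k i - 1 - if i = 0 then 1 else 0) = k := by
      funext i
      have := h1 i
      simp only [shf]
      split_ifs with h
      · subst h
        change 2 ≤ k 0 at h2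
        omega
      · omega
    refine ⟨_, ?_, hk⟩
    rw [Finset.Nat.mem_antidiagonalTuple]
    have := hsum (fun i => k i - 1 - if i = 0 then 1 else 0)
    rw [hk, hs] at this
    omega
  · intro e _
    rw [mzv_ofFn]
end

section
/- (Theorem 2.1; Hoffman's derivation relation.) For every admissible word w of H⁰, ζ̂(D(w)) = ζ̂(D̄(w)). Equivalently, for every admissible sequence (k₁,…,k_l): ∑_{i=1}^{l} ζ(k₁,…,k_{i−1}, k_i+1, k_{i+1},…,k_l) = ∑_{i=1}^{l} ∑_{j=1}^{k_i−1} ζ(k₁,…,k_{i−1}, j+1, k_i−j, k_{i+1},…,k_l). -/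
/-- truncated multiple zeta sums -/
noncomputable def hdrZ : List ℕ → ℕ → ℝ
  | [], _ => 1
  | a :: t, N => ∑ i ∈ Finset.range N, (((i : ℝ) + 1) ^ a)⁻¹ * hdrZ t i

/-- harmonic numbers -/
noncomputable def hdrH (n : ℕ) : ℝ := ∑ i ∈ Finset.range n, ((i : ℝ) + 1)⁻¹

noncomputable def hdrE (t : List ℕ) (N : ℕ) : ℝ :=
  hdrZ t N * hdrH N - ∑ q ∈ Finset.range N, hdrZ t q * ((N : ℝ) - q)⁻¹

noncomputable def hdrL : List ℕ → ℕ → ℝ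
  | [], _ => 0
  | a :: t, N => hdrZ ((a + 1) :: t) N +
      ∑ i ∈ Finset.range N, (((i : ℝ) + 1) ^ a)⁻¹ * hdrL t i

noncomputable def hdrR : List ℕ → ℕ → ℝ
  | [], _ => 0
  | a :: t, N => (∑ j ∈ Finset.range (a - 1), hdrZ ((j + 2) :: (a - (j + 1)) :: t) N) +
      ∑ i ∈ Finset.range N, (((i : ℝ) + 1) ^ a)⁻¹ * hdrR t i

lemma hdrH_reflect (M N q : ℕ) (h : N = q + 1 + M) :
    ∑ p ∈ Finset.Ico (q + 1) N, ((N : ℝ) - p)⁻¹ = hdrH M := by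
  subst h
  rw [Finset.sum_Ico_eq_sum_range, hdrH, ← Finset.sum_range_reflect]
  rw [show q + 1 + M - (q + 1) = M by omega]
  refine Finset.sum_congr rfl fun i hi => ?_
  rw [Finset.mem_range] at hi
  congr 1
  have : ((M - 1 - i : ℕ) : ℝ) + 1 + i = M := by
    have : (M - 1 - i) + 1 + i = M := by omega
    exact_mod_cast this
  push_cast
  linarith

lemma hdr_swap (a : ℕ) (t : List ℕ) (N : ℕ) :
    ∑ q ∈ Finset.range N, hdrZ (a :: t) q * ((N : ℝ) - q)⁻¹ =
      ∑ q ∈ Finset.range N, (((q : ℝ) + 1) ^ a)⁻¹ * hdrZ t q * hdrH (N - 1 - q) := by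
  simp only [hdrZ, Finset.sum_mul]
  rw [Finset.sum_comm' (t' := Finset.range N) (s' := fun q => Finset.Ico (q + 1) N)]
  · refine Finset.sum_congr rfl fun q hq => ?_
    rw [Finset.mem_range] at hq
    rw [← Finset.mul_sum, hdrH_reflect (N - 1 - q) N q (by omega)]
  · intro x y
    simp only [Finset.mem_range, Finset.mem_Ico]
    omega

lemma hdrE_cons (a : ℕ) (t : List ℕ) (N : ℕ) :
    hdrE (a :: t) N = hdrZ (a :: t) N * hdrH N -
      ∑ q ∈ Finset.range N, (((q : ℝ) + 1) ^ a)⁻¹ * hdrZ t q * hdrH (N - 1 - q) := by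
  rw [hdrE, hdr_swap]

lemma hdrE_nil (N : ℕ) : hdrE [] N = 0 := by
  rw [hdrE]
  simp only [hdrZ, one_mul]
  rw [hdrH, ← Finset.sum_range_reflect, sub_eq_zero]
  refine Finset.sum_congr rfl fun i hi => ?_
  rw [Finset.mem_range] at hi
  congr 1
  have : ((N - 1 - i : ℕ) : ℝ) + 1 + i = N := by
    have : (N - 1 - i) + 1 + i = N := by omega
    exact_mod_cast this
  linarith

lemma hdr_geom (c : ℕ) (x y : ℝ) (hx : x ≠ 0) (hy : y ≠ 0) (hxy : x - y ≠ 0) :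
    ∑ j ∈ Finset.range c, (x ^ (j + 2))⁻¹ * (y ^ (c - j))⁻¹ =
      ((y ^ (c + 1))⁻¹ - (x ^ (c + 1))⁻¹) * (x - y)⁻¹ - x⁻¹ * (y ^ (c + 1))⁻¹ := by
  induction c with
  | zero => simp; field_simp; ring
  | succ c ih =>
    rw [Finset.sum_range_succ]
    have : ∑ j ∈ Finset.range c, (x ^ (j + 2))⁻¹ * (y ^ (c + 1 - j))⁻¹ =
        (∑ j ∈ Finset.range c, (x ^ (j + 2))⁻¹ * (y ^ (c - j))⁻¹) * y⁻¹ := by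
      rw [Finset.sum_mul]
      refine Finset.sum_congr rfl fun j hj => ?_
      rw [Finset.mem_range] at hj
      rw [show c + 1 - j = (c - j) + 1 by omega, pow_succ y, mul_inv, mul_assoc]
    rw [this, ih, show c + 1 - c = 1 by omega]
    field_simp
    ring

lemma hdrH_succ (n : ℕ) : hdrH (n + 1) = hdrH n + ((n : ℝ) + 1)⁻¹ := by
  rw [hdrH, Finset.sum_range_succ]; rfl

lemma hdrZ_succ (a : ℕ) (t : List ℕ) (N : ℕ) :
    hdrZ (a :: t) (N + 1) = hdrZ (a :: t) N + (((N : ℝ) + 1) ^ a)⁻¹ * hdrZ t N := by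
  simp only [hdrZ, Finset.sum_range_succ]

lemma hdr_step (c : ℕ) (t : List ℕ) (N : ℕ) :
    ∑ j ∈ Finset.range c, (((N : ℝ) + 1) ^ (j + 2))⁻¹ * hdrZ ((c - j) :: t) N =
      ∑ q ∈ Finset.range N, (((((q : ℝ) + 1) ^ (c + 1))⁻¹ - (((N : ℝ) + 1) ^ (c + 1))⁻¹) *
        ((N : ℝ) - q)⁻¹ - ((N : ℝ) + 1)⁻¹ * (((q : ℝ) + 1) ^ (c + 1))⁻¹) * hdrZ t q := by
  simp only [hdrZ, Finset.mul_sum]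
  rw [Finset.sum_comm]
  refine Finset.sum_congr rfl fun q hq => ?_
  rw [Finset.mem_range] at hq
  have h : (q : ℝ) < N := by exact_mod_cast hq
  have := hdr_geom c ((N : ℝ) + 1) ((q : ℝ) + 1) (by positivity) (by positivity)
    (by intro h'; linarith)
  rw [show ((N : ℝ) + 1) - (q + 1) = N - q by ring] at this
  rw [← this, Finset.sum_mul]
  refine Finset.sum_congr rfl fun j _ => by ring

lemma hdrA (c : ℕ) (t : List ℕ) (N : ℕ) :
    (∑ j ∈ Finset.range c, hdrZ ((j + 2) :: (c - j) :: t) N) + hdrE ((c + 1) :: t) N =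
      hdrZ ((c + 2) :: t) N +
        ∑ p ∈ Finset.range N, (((p : ℝ) + 1) ^ (c + 1))⁻¹ * hdrE t p := by
  induction N with
  | zero => simp [hdrE, hdrZ]
  | succ N ih =>
    rw [Finset.sum_range_succ _ N]
    rw [hdrZ_succ (c + 2)]
    simp_rw [hdrZ_succ (_ + 2)]
    rw [Finset.sum_add_distrib, hdr_step]
    rw [hdrE_cons] at ih ⊢
    rw [hdrZ_succ, hdrH_succ, Finset.sum_range_succ _ N]
    rw [show N + 1 - 1 - N = 0 by omega, show hdrH 0 = 0 by simp [hdrH]]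
    have h1 : ∑ q ∈ Finset.range N, (((q : ℝ) + 1) ^ (c + 1))⁻¹ * hdrZ t q * hdrH (N + 1 - 1 - q)
        = (∑ q ∈ Finset.range N, (((q : ℝ) + 1) ^ (c + 1))⁻¹ * hdrZ t q * hdrH (N - 1 - q)) +
          ∑ q ∈ Finset.range N, (((q : ℝ) + 1) ^ (c + 1))⁻¹ * hdrZ t q * ((N : ℝ) - q)⁻¹ := by
      rw [← Finset.sum_add_distrib]
      refine Finset.sum_congr rfl fun q hq => ?_
      rw [Finset.mem_range] at hq
      rw [show N + 1 - 1 - q = (N - 1 - q) + 1 by omega, hdrH_succ]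
      have : ((N - 1 - q : ℕ) : ℝ) + 1 = N - q := by
        have : (N - 1 - q) + 1 + q = N := by omega
        have : ((N - 1 - q : ℕ) : ℝ) + 1 + q = N := by exact_mod_cast this
        linarith
      rw [this]; ring
    have h2 : ∑ q ∈ Finset.range N,
        (((((q : ℝ) + 1) ^ (c + 1))⁻¹ - (((N : ℝ) + 1) ^ (c + 1))⁻¹) *
        ((N : ℝ) - q)⁻¹ - ((N : ℝ) + 1)⁻¹ * (((q : ℝ) + 1) ^ (c + 1))⁻¹) * hdrZ t q =
        (∑ q ∈ Finset.range N, (((q : ℝ) + 1) ^ (c + 1))⁻¹ * hdrZ t q * ((N : ℝ) - q)⁻¹) -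
        (((N : ℝ) + 1) ^ (c + 1))⁻¹ * (∑ q ∈ Finset.range N, hdrZ t q * ((N : ℝ) - q)⁻¹) -
        ((N : ℝ) + 1)⁻¹ * hdrZ ((c + 1) :: t) N := by
      simp only [hdrZ]
      rw [Finset.mul_sum, Finset.mul_sum, ← Finset.sum_sub_distrib, ← Finset.sum_sub_distrib]
      refine Finset.sum_congr rfl fun q hq => by ring
    rw [h1, h2, hdrE]
    have h3 : (((N : ℝ) + 1) ^ (c + 2))⁻¹ = (((N : ℝ) + 1) ^ (c + 1))⁻¹ * ((N : ℝ) + 1)⁻¹ := by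
      rw [pow_succ _ (c + 1), mul_inv]
    rw [h3]
    linear_combination ih

lemma hdr_main (k : List ℕ) (hpos : ∀ a ∈ k, 1 ≤ a) (N : ℕ) :
    hdrR k N + hdrE k N = hdrL k N := by
  induction k generalizing N with
  | nil => simp [hdrR, hdrL, hdrE_nil]
  | cons a t ih =>
    have ih' := ih (fun b hb => hpos b (List.mem_cons_of_mem _ hb))
    obtain ⟨c, rfl⟩ : ∃ c, a = c + 1 := ⟨a - 1, by have := hpos a (by simp); omega⟩
    have hA := hdrA c t N
    simp only [hdrR, hdrL, Nat.add_sub_cancel]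
    simp only [← ih', mul_add, Finset.sum_add_distrib]
    simp only [Nat.add_sub_add_right]
    linear_combination hA

lemma hdrL_eq (k : List ℕ) (N : ℕ) :
    ∑ i : Fin k.length, hdrZ (k.take i.1 ++ (k.get i + 1) :: k.drop (i.1 + 1)) N = hdrL k N := by
  induction k generalizing N with
  | nil => simp [hdrL]
  | cons a t ih =>
    simp only [List.length_cons]
    rw [Fin.sum_univ_succ, hdrL]
    congr 1
    simp only [← ih, Finset.mul_sum]
    rw [Finset.sum_comm]
    refine Finset.sum_congr rfl fun i _ => ?_
    simp [hdrZ]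

lemma hdrR_eq (k : List ℕ) (N : ℕ) :
    ∑ i : Fin k.length, ∑ j ∈ Finset.range (k.get i - 1),
      hdrZ (k.take i.1 ++ (j + 2) :: (k.get i - (j + 1)) :: k.drop (i.1 + 1)) N = hdrR k N := by
  induction k generalizing N with
  | nil => simp [hdrR]
  | cons a t ih =>
    simp only [List.length_cons]
    rw [Fin.sum_univ_succ, hdrR]
    congr 1
    simp only [← ih, Finset.mul_sum]
    rw [Finset.sum_comm]
    refine Finset.sum_congr rfl fun i _ => ?_
    rw [Finset.sum_comm]
    simp [hdrZ]

/-! ### analytic part -/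

lemma hdrZ_nonneg (k : List ℕ) (N : ℕ) : 0 ≤ hdrZ k N := by
  induction k generalizing N with
  | nil => simp [hdrZ]
  | cons a t ih => exact Finset.sum_nonneg fun i _ => mul_nonneg (by positivity) (ih i)

lemma hdrH_nonneg (N : ℕ) : 0 ≤ hdrH N := Finset.sum_nonneg fun i _ => by positivity

lemma hdrH_mono : Monotone hdrH := monotone_nat_of_le_succ fun n => by
  rw [hdrH_succ]
  have : 0 ≤ ((n : ℝ) + 1)⁻¹ := by positivity
  linarith

lemma hdrZ_le (k : List ℕ) (hpos : ∀ a ∈ k, 1 ≤ a) (N : ℕ) : hdrZ k N ≤ hdrH N ^ k.length := by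
  induction k generalizing N with
  | nil => simp [hdrZ]
  | cons a t ih =>
    have ih' := ih (fun b hb => hpos b (List.mem_cons_of_mem _ hb))
    rw [hdrZ, List.length_cons, pow_succ', hdrH, Finset.sum_mul]
    refine Finset.sum_le_sum fun i hi => ?_
    have h1 : (((i : ℝ) + 1) ^ a)⁻¹ ≤ ((i : ℝ) + 1)⁻¹ := by
      apply inv_anti₀ (by positivity)
      exact le_self_pow₀ (by linarith [(Nat.cast_nonneg i : (0 : ℝ) ≤ i)])
        (by have := hpos a (by simp); omega)
    refine mul_le_mul h1 ((ih' i).trans ?_) (hdrZ_nonneg _ _) (by positivity)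
    exact pow_le_pow_left₀ (hdrH_nonneg i) (hdrH_mono (Finset.mem_range.1 hi).le) _

lemma hdrH_le (n : ℕ) : hdrH (n + 1) ≤ 1 + Real.log (n + 1) := by
  have := harmonic_le_one_add_log (n + 1)
  simp only [harmonic] at this
  push_cast at this
  exact this

lemma hdr_summable (l : ℕ) :
    Summable fun i : ℕ => (((i : ℝ) + 1) ^ 2)⁻¹ * hdrH (i + 1) ^ l := by
  set e : ℝ := 1 / (2 * ((l : ℝ) + 1)) with he
  have hepos : 0 < e := by positivity
  have hb : ∀ n : ℕ, hdrH (n + 1) ≤ (1 + 1 / e) * ((n : ℝ) + 1) ^ e := by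
    intro n
    have h1 : (1 : ℝ) ≤ ((n : ℝ) + 1) ^ e :=
      Real.one_le_rpow (by linarith [(Nat.cast_nonneg n : (0 : ℝ) ≤ n)]) hepos.le
    have h2 := Real.log_le_rpow_div (x := (n : ℝ) + 1) (by positivity) hepos
    have := hdrH_le n
    calc _ ≤ _ := this
      _ ≤ ((n : ℝ) + 1) ^ e + ((n : ℝ) + 1) ^ e / e := add_le_add h1 h2
      _ = _ := by ring
  have hs : Summable fun i : ℕ => (1 + 1 / e) ^ l * (((i + 1 : ℕ) : ℝ) ^ (-(3/2) : ℝ)) := by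
    apply Summable.mul_left
    exact (summable_nat_add_iff 1).2 (Real.summable_nat_rpow.2 (by norm_num))
  refine Summable.of_nonneg_of_le
    (fun i => mul_nonneg (by positivity) (pow_nonneg (hdrH_nonneg _) _)) (fun i => ?_) hs
  have hi : (0 : ℝ) < (i : ℝ) + 1 := by positivity
  have hi1 : (1 : ℝ) ≤ (i : ℝ) + 1 := by linarith [(Nat.cast_nonneg i : (0 : ℝ) ≤ i)]
  have h3 : hdrH (i + 1) ^ l ≤ (1 + 1 / e) ^ l * ((i : ℝ) + 1) ^ (1/2 : ℝ) := by
    refine (pow_le_pow_left₀ (hdrH_nonneg _) (hb i) l).trans ?_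
    rw [mul_pow]
    refine mul_le_mul_of_nonneg_left ?_ (by positivity)
    rw [← Real.rpow_mul_natCast hi.le]
    refine Real.rpow_le_rpow_of_exponent_le hi1 ?_
    rw [he, div_mul_eq_mul_div, div_le_div_iff₀ (by positivity) (by norm_num)]
    nlinarith
  refine (mul_le_mul_of_nonneg_left h3 (by positivity)).trans (le_of_eq ?_)
  push_cast
  have : (((i : ℝ) + 1) ^ 2)⁻¹ = ((i : ℝ) + 1) ^ (-2 : ℝ) := by
    rw [Real.rpow_neg hi.le]; norm_num
  rw [this, mul_left_comm, ← Real.rpow_add hi]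
  norm_num

lemma hdr_bound_term (a : ℕ) (t : List ℕ) (ha : 2 ≤ a) (hpos : ∀ b ∈ t, 1 ≤ b) (i : ℕ) :
    (((i : ℝ) + 1) ^ a)⁻¹ * hdrZ t i ≤ (((i : ℝ) + 1) ^ 2)⁻¹ * hdrH (i + 1) ^ t.length := by
  refine mul_le_mul ?_ ((hdrZ_le t hpos i).trans ?_) (hdrZ_nonneg _ _) (by positivity)
  · apply inv_anti₀ (by positivity)
    exact pow_le_pow_right₀ (by linarith [(Nat.cast_nonneg i : (0 : ℝ) ≤ i)]) ha
  · exact pow_le_pow_left₀ (hdrH_nonneg i) (hdrH_mono (Nat.le_succ i)) _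

lemma hdrZ_bdd (a : ℕ) (t : List ℕ) (ha : 2 ≤ a) (hpos : ∀ b ∈ t, 1 ≤ b) :
    ∃ C, ∀ N, hdrZ (a :: t) N ≤ C := by
  refine ⟨∑' i : ℕ, (((i : ℝ) + 1) ^ 2)⁻¹ * hdrH (i + 1) ^ t.length, fun N => ?_⟩
  · exact (Finset.sum_le_sum fun i _ => hdr_bound_term a t ha hpos i).trans
      ((hdr_summable t.length).sum_le_tsum _
        (fun i _ => mul_nonneg (by positivity) (pow_nonneg (hdrH_nonneg _) _)))

lemma hdrH_diff_le (m n : ℕ) : hdrH (m + n) - hdrH m ≤ hdrH n := by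
  induction n with
  | zero => simp [hdrH]
  | succ n ih =>
    rw [← add_assoc, hdrH_succ, hdrH_succ]
    have : (((m + n : ℕ) : ℝ) + 1)⁻¹ ≤ ((n : ℝ) + 1)⁻¹ := by
      apply inv_anti₀ (by positivity)
      push_cast
      linarith [(Nat.cast_nonneg m : (0 : ℝ) ≤ m)]
    linarith

open Filter Topology in
lemma hdrH_diff_tendsto (n : ℕ) :
    Tendsto (fun N => hdrH N - hdrH (N - n)) atTop (𝓝 0) := by
  suffices h : Tendsto (fun m => hdrH (m + n) - hdrH m) atTop (𝓝 0) by
    refine (tendsto_add_atTop_iff_nat n).1 ?_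
    simpa using h
  induction n with
  | zero => simp
  | succ n ih =>
    have h1 : Tendsto (fun m : ℕ => (((m + n : ℕ) : ℝ) + 1)⁻¹) atTop (𝓝 0) := by
      have := (tendsto_add_atTop_iff_nat n).2 (tendsto_one_div_add_atTop_nhds_zero_nat (𝕜 := ℝ))
      simpa using this
    have := ih.add h1
    rw [add_zero] at this
    refine this.congr fun m => ?_
    rw [← add_assoc, hdrH_succ]; ring

open Filter Topology in
lemma hdrE_tendsto (a : ℕ) (t : List ℕ) (ha : 2 ≤ a) (hpos : ∀ b ∈ t, 1 ≤ b) :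
    Tendsto (hdrE (a :: t)) atTop (𝓝 0) := by
  have hE : ∀ N, hdrE (a :: t) N = ∑' i : ℕ, if i < N then
      ((((i : ℝ) + 1) ^ a)⁻¹ * hdrZ t i) * (hdrH N - hdrH (N - (i + 1))) else 0 := by
    intro N
    rw [tsum_eq_sum (s := Finset.range N) (fun i hi => by
      rw [Finset.mem_range] at hi; simp [hi])]
    rw [hdrE_cons, hdrZ, Finset.sum_mul, ← Finset.sum_sub_distrib]
    refine Finset.sum_congr rfl fun i hi => ?_
    rw [Finset.mem_range] at hi
    rw [if_pos hi, show N - 1 - i = N - (i + 1) by omega]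
    ring
  rw [show hdrE (a :: t) = _ from funext hE]
  have h00 : 𝓝 (∑' _ : ℕ, (0 : ℝ)) ≤ 𝓝 0 := by rw [tsum_zero]
  refine Tendsto.mono_right ?_ h00
  refine tendsto_tsum_of_dominated_convergence (hdr_summable (t.length + 1)) ?_ ?_
  · intro i
    have := (hdrH_diff_tendsto (i + 1)).const_mul ((((i : ℝ) + 1) ^ a)⁻¹ * hdrZ t i)
    rw [mul_zero] at this
    refine this.congr' ?_
    filter_upwards [eventually_gt_atTop i] with N hN
    rw [if_pos hN]
  · refine Eventually.of_forall fun N i => ?_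
    split_ifs with h
    · have h0 : 0 ≤ (((i : ℝ) + 1) ^ a)⁻¹ * hdrZ t i :=
        mul_nonneg (by positivity) (hdrZ_nonneg _ _)
      have h1 : 0 ≤ hdrH N - hdrH (N - (i + 1)) := sub_nonneg.2 (hdrH_mono (Nat.sub_le _ _))
      rw [Real.norm_of_nonneg (mul_nonneg h0 h1), pow_succ (hdrH (i + 1)),
        ← mul_assoc]
      refine mul_le_mul (hdr_bound_term a t ha hpos i) ?_ h1
        (mul_nonneg (by positivity) (pow_nonneg (hdrH_nonneg _) _))
      have := hdrH_diff_le (N - (i + 1)) (i + 1)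
      rwa [show N - (i + 1) + (i + 1) = N by omega] at this
    · rw [norm_zero]
      exact mul_nonneg (by positivity) (pow_nonneg (hdrH_nonneg _) _)

lemma hdr_box (k : List ℕ) (M N : ℕ) (hN : N ≤ M) :
    ∑ n ∈ Fintype.piFinset (fun _ : Fin k.length => Finset.range (M + 1)),
      (if ((∀ i j : Fin k.length, i < j → n j < n i) ∧ (∀ i, 1 ≤ n i)) ∧ ∀ i, n i ≤ N then
        ∏ i : Fin k.length, ((n i : ℝ) ^ k.get i)⁻¹ else 0) = hdrZ k N := by
  induction k generalizing N with
  | nil => simp [hdrZ]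
  | cons a t ih =>
    have key : ∑ n ∈ Fintype.piFinset (fun _ : Fin (t.length + 1) => Finset.range (M + 1)),
      (if ((∀ i j : Fin (t.length + 1), i < j → n j < n i) ∧ (∀ i, 1 ≤ n i)) ∧ ∀ i, n i ≤ N then
        ∏ i : Fin (t.length + 1), ((n i : ℝ) ^ (a :: t).get i)⁻¹ else 0) =
        ∑ m ∈ Finset.range (M + 1),
          ∑ n ∈ Fintype.piFinset (fun _ : Fin t.length => Finset.range (M + 1)),
          if 1 ≤ m ∧ m ≤ N then ((m : ℝ) ^ a)⁻¹ *
            (if ((∀ i j : Fin t.length, i < j → n j < n i) ∧ (∀ i, 1 ≤ n i)) ∧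
                ∀ i, n i ≤ m - 1 then
              ∏ i : Fin t.length, ((n i : ℝ) ^ t.get i)⁻¹ else 0) else 0 := by
      rw [← Finset.sum_product']
      symm
      refine Finset.sum_nbij' (fun p => (Fin.cons p.1 p.2 : Fin (t.length + 1) → ℕ))
        (fun n => (n 0, Fin.tail n)) ?_ ?_ ?_ ?_ ?_
      · rintro ⟨m, n⟩ h
        simp only [Finset.mem_product, Fintype.mem_piFinset] at h ⊢
        intro i
        refine Fin.cases ?_ (fun i => ?_) i
        · simpa using h.1
        · simpa using h.2 i
      · intro n h
        simp only [Finset.mem_product, Fintype.mem_piFinset] at h ⊢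
        exact ⟨h 0, fun i => h i.succ⟩
      · rintro ⟨m, n⟩ _
        simp
      · intro n _
        simp
      · rintro ⟨m, n⟩ _
        have hc : (((∀ i j : Fin (t.length + 1), i < j →
              (Fin.cons m n : Fin (t.length + 1) → ℕ) j < (Fin.cons m n : Fin (t.length + 1) → ℕ) i)
            ∧ (∀ i, 1 ≤ (Fin.cons m n : Fin (t.length + 1) → ℕ) i)) ∧
            ∀ i, (Fin.cons m n : Fin (t.length + 1) → ℕ) i ≤ N) ↔
            (1 ≤ m ∧ m ≤ N) ∧ ((∀ i j : Fin t.length, i < j → n j < n i) ∧ (∀ i, 1 ≤ n i)) ∧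
                ∀ i, n i ≤ m - 1 := by
          simp only [Fin.forall_fin_succ, Fin.cons_zero, Fin.cons_succ, Fin.succ_lt_succ_iff,
            Fin.succ_pos, Fin.not_lt_zero, IsEmpty.forall_iff, forall_true_left,
            true_and]
          constructor
          · rintro ⟨⟨⟨h1, h2⟩, h3, h4⟩, h5, h6⟩
            exact ⟨⟨h3, h5⟩, ⟨by tauto, h4⟩, fun i => by have := h1 i; omega⟩
          · rintro ⟨⟨h3, h5⟩, ⟨h2, h4⟩, h1⟩
            exact ⟨⟨⟨fun i => by have := h1 i; omega, by tauto⟩, h3, h4⟩, h5,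
              fun i => by have := h1 i; omega⟩
        simp only [hc, ite_and, Fin.prod_univ_succ]
        simp only [← ite_and]
        by_cases h1 : 1 ≤ m ∧ m ≤ N
        · simp [h1]
        · rw [if_neg h1, if_neg (fun h => h1 ⟨h.1, h.2.1⟩)]
    refine Eq.trans key ?_
    rw [hdrZ, Finset.sum_range_succ']
    simp only [nonpos_iff_eq_zero, one_ne_zero, false_and, if_false, Finset.sum_const_zero,
      add_zero]
    rw [← Finset.sum_subset (Finset.range_subset_range.2 hN)]
    · refine Finset.sum_congr rfl fun i hi => ?_
      rw [Finset.mem_range] at hi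
      have : 1 ≤ i + 1 ∧ i + 1 ≤ N := by omega
      simp only [this, and_self, if_true]
      rw [← Finset.mul_sum, Nat.add_sub_cancel, ih i (by omega)]
      push_cast
      rfl
    · intro i _ hi
      rw [Finset.mem_range] at hi
      have : ¬ (1 ≤ i + 1 ∧ i + 1 ≤ N) := by omega
      simp only [if_neg this, Finset.sum_const_zero]

open Filter Topology in
lemma hdrZ_tendsto (a : ℕ) (t : List ℕ) (ha : 2 ≤ a) (hpos : ∀ b ∈ t, 1 ≤ b) :
    Tendsto (hdrZ (a :: t)) atTop (𝓝 (mzv (a :: t))) := by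
  set k := a :: t with hk
  obtain ⟨C, hC⟩ := hdrZ_bdd a t ha hpos
  set f : (Fin k.length → ℕ) → ℝ := fun n =>
    if (∀ i j : Fin k.length, i < j → n j < n i) ∧ (∀ i, 1 ≤ n i) then
      ∏ i : Fin k.length, ((n i : ℝ) ^ k.get i)⁻¹ else 0 with hf
  set box : ℕ → Finset (Fin k.length → ℕ) := fun N =>
    Fintype.piFinset (fun _ : Fin k.length => Finset.range (N + 1)) with hbox
  have hb : ∀ N, ∑ n ∈ box N, f n = hdrZ k N := by
    intro N
    rw [← hdr_box k N N le_rfl]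
    refine Finset.sum_congr rfl fun n hn => ?_
    have : ∀ i, n i ≤ N := fun i => by
      have := Fintype.mem_piFinset.1 hn i
      rw [Finset.mem_range] at this; omega
    simp only [hf, this, implies_true, and_true]
  have hf0 : ∀ n, 0 ≤ f n := fun n => by
    simp only [hf]
    split_ifs
    · exact Finset.prod_nonneg fun i _ => by positivity
    · exact le_rfl
  have hmono : Monotone box := fun A B h =>
    Fintype.piFinset_subset _ _ fun _ => Finset.range_subset_range.2 (by omega)
  have htend : Tendsto box atTop atTop := by
    refine tendsto_atTop_finset_of_monotone hmono fun n => ⟨∑ i, n i, ?_⟩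
    refine Fintype.mem_piFinset.2 fun i => Finset.mem_range.2 (Nat.lt_succ_of_le ?_)
    exact Finset.single_le_sum (f := n) (fun _ _ => Nat.zero_le _) (Finset.mem_univ i)
  have hs : Summable f := by
    refine summable_of_sum_le hf0 (c := C) fun u => ?_
    obtain ⟨N, hN⟩ := (htend.eventually (eventually_ge_atTop u)).exists
    exact (Finset.sum_le_sum_of_subset_of_nonneg hN fun n _ _ => hf0 n).trans
      ((hb N).le.trans (hC N))
  have := hs.hasSum.comp htend
  exact this.congr hb

open Filter Topology in
lemma hdrZ_tendsto_of_exists (k : List ℕ) (hk : ∃ a t, k = a :: t ∧ 2 ≤ a ∧ ∀ b ∈ t, 1 ≤ b) :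
    Tendsto (hdrZ k) atTop (𝓝 (mzv k)) := by
  obtain ⟨a, t, rfl, h1, h2⟩ := hk
  exact hdrZ_tendsto a t h1 h2

/-- replacing the entry at position `i` by a nonempty admissible-headed list -/
lemma hdr_adm (k : List ℕ) (hpos : ∀ a ∈ k, 1 ≤ a) (hadm : ∃ a t, k = a :: t ∧ 2 ≤ a)
    (i c : ℕ) (s : List ℕ) (hc : 2 ≤ c) (hs : ∀ b ∈ s, 1 ≤ b) :
    ∃ a t, k.take i ++ c :: (s ++ k.drop (i + 1)) = a :: t ∧ 2 ≤ a ∧ ∀ b ∈ t, 1 ≤ b := by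
  obtain ⟨a, t, rfl, ha⟩ := hadm
  have ht : ∀ b ∈ t, 1 ≤ b := fun b hb => hpos b (List.mem_cons_of_mem _ hb)
  cases i with
  | zero =>
    refine ⟨c, s ++ t, by simp, hc, fun b hb => ?_⟩
    rcases List.mem_append.1 hb with h | h
    · exact hs b h
    · exact ht b h
  | succ i =>
    refine ⟨a, t.take i ++ c :: (s ++ t.drop (i + 1)), by simp, ha, fun b hb => ?_⟩
    simp only [List.mem_append, List.mem_cons] at hb
    rcases hb with h | h | h | h
    · exact ht b (List.mem_of_mem_take h)
    · omega
    · exact hs b h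
    · exact ht b (List.mem_of_mem_drop h)

/-- **Hoffman's derivation relation (Theorem 2.1), explicit form.**  For every admissible
sequence `(k₁,…,k_l)`:
`∑_{i=1}^l ζ(k₁,…,k_{i-1},k_i+1,k_{i+1},…,k_l)
  = ∑_{i=1}^l ∑_{j=1}^{k_i-1} ζ(k₁,…,k_{i-1}, j+1, k_i-j, k_{i+1},…,k_l)`.
(In the inner sum below `j` runs over `0,…,k_i-2`, standing for the paper's `j-1`;
the term is `ζ(…, (j+1)+1, k_i-(j+1), …)`.) -/
theorem hoffman_derivation_relation (k : List ℕ)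
    (hpos : ∀ a ∈ k, 1 ≤ a) (hadm : ∃ a t, k = a :: t ∧ 2 ≤ a) :
    ∑ i : Fin k.length, mzv (k.take i.1 ++ (k.get i + 1) :: k.drop (i.1 + 1)) =
      ∑ i : Fin k.length, ∑ j ∈ Finset.range (k.get i - 1),
        mzv (k.take i.1 ++ (j + 2) :: (k.get i - (j + 1)) :: k.drop (i.1 + 1)) := by
  have hL : Filter.Tendsto (hdrL k) Filter.atTop (nhds (∑ i : Fin k.length,
      mzv (k.take i.1 ++ (k.get i + 1) :: k.drop (i.1 + 1)))) := by
    rw [show hdrL k = _ from funext fun N => (hdrL_eq k N).symm]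
    refine tendsto_finsetSum _ fun i _ => hdrZ_tendsto_of_exists _ ?_
    have := hpos _ (List.get_mem k i)
    simpa using hdr_adm k hpos hadm i (k.get i + 1) [] (by omega) (by simp)
  have hR : Filter.Tendsto (hdrR k) Filter.atTop (nhds (∑ i : Fin k.length,
      ∑ j ∈ Finset.range (k.get i - 1),
        mzv (k.take i.1 ++ (j + 2) :: (k.get i - (j + 1)) :: k.drop (i.1 + 1)))) := by
    rw [show hdrR k = _ from funext fun N => (hdrR_eq k N).symm]
    refine tendsto_finsetSum _ fun i _ => tendsto_finsetSum _ fun j hj =>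
      hdrZ_tendsto_of_exists _ ?_
    rw [Finset.mem_range] at hj
    exact hdr_adm k hpos hadm i (j + 2) [k.get i - (j + 1)] (by omega)
      (fun b hb => by rw [List.mem_singleton] at hb; omega)
  have hE : Filter.Tendsto (hdrE k) Filter.atTop (nhds 0) := by
    obtain ⟨a, t, rfl, ha⟩ := hadm
    exact hdrE_tendsto a t ha fun b hb => hpos b (List.mem_cons_of_mem _ hb)
  have h := hR.add hE
  rw [add_zero] at h
  exact tendsto_nhds_unique hL (h.congr fun N => hdr_main k hpos N)
end

section
/- (Theorem 3.2.) For any positive integers k₁,…,k_l with k_i ≥ 2 for some i, T(k₁,…,k_l) − T(k₂,…,k_l,k₁) = ζ(k₁+1, k₂,…,k_l) − ∑_{j=0}^{k₁−2} ζ(k₁−j, k₂,…,k_l, j+1), where the sum on the right is understood as 0 when k₁ = 1. -/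
/-- `T(k₁,…,k_l) = ∑_{n₁>⋯>n_l>n_{l+1}≥0} 1/((n₁-n_{l+1}) n₁^{k₁} ⋯ n_l^{k_l})`. -/
noncomputable def Tval (k : List ℕ) : ℝ :=
  ∑' n : Fin (k.length + 1) → ℕ,
    if ∀ i j : Fin (k.length + 1), i < j → n j < n i then
      (((n 0 : ℝ) - (n (Fin.last k.length) : ℝ)) *
        ∏ i : Fin k.length, (n i.castSucc : ℝ) ^ k.get i)⁻¹
    else 0


namespace PF

open Finset

/-- weight `n^{-k}`, zero at `n = 0` -/
noncomputable def wt (k n : ℕ) : ENNReal :=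
  if n = 0 then 0 else ENNReal.ofReal (((n : ℝ) ^ k)⁻¹)

/-- `1/(n-m)` -/
noncomputable def vt (n m : ℕ) : ENNReal := ENNReal.ofReal (((n : ℝ) - m)⁻¹)

/-- nested sums below `b` -/
noncomputable def NS : List ℕ → ℕ → (ℕ → ENNReal) → ENNReal
  | [], b, F => F b
  | k :: ks, b, F => ∑ n ∈ range b, wt k n * NS ks n F

noncomputable def ZE (c : ℕ) (t : List ℕ) : ENNReal := ∑' n, wt c n * NS t n (fun _ => 1)

noncomputable def TE (c : ℕ) (t : List ℕ) : ENNReal :=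
  ∑' n, wt c n * NS t n (fun x => ∑ m ∈ range x, vt n m)

lemma tsum_peel (l : ℕ) (f : (Fin (l + 1) → ℕ) → ENNReal) :
    ∑' n, f n = ∑' x : ℕ, ∑' n : Fin l → ℕ, f (Fin.cons x n) := by
  rw [← (Fin.consEquiv (fun _ : Fin (l+1) => ℕ)).tsum_eq]
  rw [ENNReal.tsum_prod']
  rfl

lemma dec_cons {l : ℕ} (x : ℕ) (n : Fin l → ℕ) :
    (∀ i j : Fin (l + 1), i < j → (Fin.cons x n : Fin (l + 1) → ℕ) j <
      (Fin.cons x n : Fin (l + 1) → ℕ) i) ↔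
      (∀ i j : Fin l, i < j → n j < n i) ∧ ∀ i, n i < x := by
  simp [Fin.forall_fin_succ]
  tauto

lemma tsum_lt (b : ℕ) (g : ℕ → ENNReal) :
    ∑' x, (if x < b then g x else 0) = ∑ x ∈ range b, g x := by
  rw [tsum_eq_sum (s := range b)]
  · exact Finset.sum_congr rfl fun x hx => by simp [Finset.mem_range.1 hx]
  · intro x hx; simp at hx; simp [hx]

lemma tupZ (k : List ℕ) : ∀ b : ℕ,
    ∑' n : Fin k.length → ℕ,
      (if ((∀ i j : Fin k.length, i < j → n j < n i) ∧ (∀ i, n i < b)) ∧ (∀ i, 1 ≤ n i) then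
      ENNReal.ofReal (∏ i : Fin k.length, ((n i : ℝ) ^ k.get i)⁻¹) else 0)
      = NS k b (fun _ => 1) := by
  induction k with
  | nil => intro b; simp [NS]
  | cons c t ih =>
    intro b
    simp only [NS]
    rw [← tsum_lt]
    show ∑' n : Fin (t.length + 1) → ℕ, _ = _
    rw [tsum_peel]
    refine tsum_congr fun x => ?_
    rw [← ih x]
    by_cases hx : x < b
    swap
    · rw [if_neg hx, ENNReal.tsum_eq_zero]
      intro n
      rw [if_neg]
      rintro ⟨⟨_, h⟩, _⟩
      exact absurd (h 0) (by simpa using hx)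
    rw [if_pos hx, ← ENNReal.tsum_mul_left]
    refine tsum_congr fun n => ?_
    have e1 := dec_cons x n
    by_cases hx0 : x = 0
    · simp only [wt, hx0, if_true, zero_mul]
      rw [if_neg]
      rintro ⟨_, h⟩
      simpa using h 0
    by_cases h : ((∀ i j : Fin t.length, i < j → n j < n i) ∧ (∀ i, n i < x)) ∧ (∀ i, 1 ≤ n i)
    · rw [if_pos h, if_pos]
      · rw [wt, if_neg hx0, ← ENNReal.ofReal_mul (by positivity)]
        congr 1
        exact Fin.prod_univ_succ _
      · refine ⟨⟨e1.2 h.1, ?_⟩, ?_⟩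
        · intro i; refine Fin.cases ?_ ?_ i
          · simpa using hx
          · intro i; simpa using (h.1.2 i).trans hx
        · intro i; refine Fin.cases ?_ ?_ i
          · simp only [Fin.cons_zero]; omega
          · intro i; simpa using h.2 i
    · rw [if_neg h, if_neg, mul_zero]
      rintro ⟨⟨h1, h2⟩, h3⟩
      exact h ⟨e1.1 h1, fun i => by simpa using h3 i.succ⟩

lemma tupT (G : ℕ → ENNReal) (k : List ℕ) : ∀ b : ℕ,
    ∑' n : Fin (k.length + 1) → ℕ,
      (if ((∀ i j : Fin (k.length + 1), i < j → n j < n i) ∧ (∀ i, n i < b)) then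
      G (n (Fin.last k.length)) *
        ENNReal.ofReal (∏ i : Fin k.length, ((n i.castSucc : ℝ) ^ k.get i)⁻¹) else 0)
      = NS k b (fun x => ∑ m ∈ range x, G m) := by
  induction k with
  | nil =>
    intro b
    simp only [NS]
    rw [← tsum_lt]
    show ∑' n : Fin (0 + 1) → ℕ, _ = _
    rw [tsum_peel]
    refine tsum_congr fun x => ?_
    rw [tsum_fintype]
    simp
  | cons c t ih =>
    intro b
    simp only [NS]
    rw [← tsum_lt]
    show ∑' n : Fin ((t.length + 1) + 1) → ℕ, _ = _
    rw [tsum_peel]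
    refine tsum_congr fun x => ?_
    rw [← ih x]
    by_cases hx : x < b
    swap
    · rw [if_neg hx, ENNReal.tsum_eq_zero]
      intro n
      rw [if_neg]
      rintro ⟨_, h⟩
      exact absurd (h 0) (by simpa using hx)
    rw [if_pos hx, ← ENNReal.tsum_mul_left]
    refine tsum_congr fun n => ?_
    have e1 := dec_cons x n
    by_cases h : ((∀ i j : Fin (t.length + 1), i < j → n j < n i) ∧ (∀ i, n i < x))
    · have hx0 : x ≠ 0 := by have := h.2 0; omega
      rw [if_pos h, if_pos]
      · rw [wt, if_neg hx0, mul_left_comm, ← ENNReal.ofReal_mul (by positivity)]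
        congr 2
        exact Fin.prod_univ_succ _
      · refine ⟨e1.2 h, ?_⟩
        · intro i; refine Fin.cases ?_ ?_ i
          · simpa using hx
          · intro i; simpa using (h.2 i).trans hx
    · rw [if_neg h, if_neg, mul_zero]
      rintro ⟨h1, h2⟩
      exact h (e1.1 h1)

lemma mzv_eq (c : ℕ) (t : List ℕ) : mzv (c :: t) = (ZE c t).toReal := by
  have : ZE c t = ∑' n : Fin (t.length + 1) → ℕ, ENNReal.ofReal
    (if (∀ i j : Fin (t.length + 1), i < j → n j < n i) ∧ (∀ i, 1 ≤ n i) then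
      ∏ i : Fin (t.length + 1), ((n i : ℝ) ^ (c :: t).get i)⁻¹
    else 0) := by
    rw [tsum_peel, ZE]
    refine tsum_congr fun x => ?_
    rw [← tupZ, ← ENNReal.tsum_mul_left]
    refine tsum_congr fun n => ?_
    have e1 := dec_cons x n
    by_cases hx0 : x = 0
    · simp only [wt, hx0, if_true, zero_mul]
      rw [if_neg, ENNReal.ofReal_zero]
      rintro ⟨_, h⟩
      simpa using h 0
    by_cases h : ((∀ i j : Fin t.length, i < j → n j < n i) ∧ (∀ i, n i < x)) ∧ (∀ i, 1 ≤ n i)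
    · rw [if_pos h, if_pos]
      · rw [wt, if_neg hx0, ← ENNReal.ofReal_mul (by positivity)]
        congr 1
        rw [Fin.prod_univ_succ]
        rfl
      · refine ⟨e1.2 h.1, ?_⟩
        · intro i; refine Fin.cases ?_ ?_ i
          · simp only [Fin.cons_zero]; omega
          · intro i; simpa using h.2 i
    · rw [if_neg h, if_neg, mul_zero, ENNReal.ofReal_zero]
      rintro ⟨h1, h3⟩
      exact h ⟨e1.1 h1, fun i => by simpa using h3 i.succ⟩
  rw [this, ENNReal.tsum_toReal_eq (fun _ => ENNReal.ofReal_ne_top), mzv]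
  refine tsum_congr fun n => ?_
  rw [ENNReal.toReal_ofReal]
  · rfl
  · split_ifs <;> positivity

lemma Tval_eq (c : ℕ) (t : List ℕ) : Tval (c :: t) = (TE c t).toReal := by
  have : TE c t = ∑' n : Fin (t.length + 1 + 1) → ℕ, ENNReal.ofReal
    (if ∀ i j : Fin (t.length + 1 + 1), i < j → n j < n i then
      (((n 0 : ℝ) - (n (Fin.last (t.length + 1)) : ℝ)) *
        ∏ i : Fin (t.length + 1), (n i.castSucc : ℝ) ^ (c :: t).get i)⁻¹
    else 0) := by
    rw [tsum_peel, TE]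
    refine tsum_congr fun x => ?_
    rw [← tupT, ← ENNReal.tsum_mul_left]
    refine tsum_congr fun n => ?_
    have e1 := dec_cons x n
    by_cases h : ((∀ i j : Fin (t.length + 1), i < j → n j < n i) ∧ (∀ i, n i < x))
    · have hx0 : x ≠ 0 := by have := h.2 0; omega
      have hl : ((n (Fin.last t.length) : ℕ) : ℝ) < x := by exact_mod_cast h.2 _
      have hl' : 0 ≤ ((x : ℝ) - (n (Fin.last t.length) : ℕ))⁻¹ :=
        inv_nonneg.2 (sub_nonneg.2 hl.le)
      rw [if_pos h, if_pos (e1.2 h)]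
      rw [wt, if_neg hx0, vt, ← ENNReal.ofReal_mul hl', ← ENNReal.ofReal_mul (by positivity)]
      congr 1
      rw [Fin.prod_univ_succ, mul_inv, mul_inv, ← Finset.prod_inv_distrib, mul_left_comm]
      rfl
    · rw [if_neg h, if_neg (fun h1 => h (e1.1 h1)), mul_zero, ENNReal.ofReal_zero]
  rw [this, ENNReal.tsum_toReal_eq (fun _ => ENNReal.ofReal_ne_top), Tval]
  refine tsum_congr fun n => ?_
  rw [ENNReal.toReal_ofReal]
  · rfl
  · split_ifs with h
    · have : ((n (Fin.last (t.length + 1)) : ℕ) : ℝ) < n 0 := by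
        exact_mod_cast h 0 (Fin.last _) (Fin.last_pos)
      have := sub_pos.2 this
      positivity
    · exact le_rfl

lemma NS_congr (t : List ℕ) : ∀ (b : ℕ) (F G : ℕ → ENNReal)
    (_ : ∀ x ≤ b, (b ≠ 0 → x ≠ 0) → F x = G x), NS t b F = NS t b G := by
  induction t with
  | nil => intro b F G h; exact h b le_rfl id
  | cons c t ih =>
    intro b F G h
    refine Finset.sum_congr rfl fun n hn => ?_
    have hn := Finset.mem_range.1 hn
    by_cases h0 : n = 0
    · simp [wt, h0]
    · rw [ih n F G fun x hx hx0 => h x (hx.trans hn.le) fun _ => hx0 h0]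

lemma NS_add (t : List ℕ) : ∀ (b : ℕ) (F G : ℕ → ENNReal),
    NS t b (fun x => F x + G x) = NS t b F + NS t b G := by
  induction t with
  | nil => intro b F G; rfl
  | cons c t ih =>
    intro b F G
    simp only [NS, ih, mul_add, Finset.sum_add_distrib]

lemma NS_mul (t : List ℕ) : ∀ (b : ℕ) (r : ENNReal) (F : ℕ → ENNReal),
    NS t b (fun x => r * F x) = r * NS t b F := by
  induction t with
  | nil => intro b r F; rfl
  | cons c t ih =>
    intro b r F
    simp only [NS, ih, Finset.mul_sum, mul_left_comm]

lemma NS_tsum (t : List ℕ) : ∀ (b : ℕ) (F : ℕ → ℕ → ENNReal),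
    NS t b (fun x => ∑' i, F i x) = ∑' i, NS t b (F i) := by
  induction t with
  | nil => intro b F; rfl
  | cons c t ih =>
    intro b F
    simp only [NS, ih]
    rw [Summable.tsum_finsetSum (fun _ _ => ENNReal.summable)]
    simp only [ENNReal.tsum_mul_left]

lemma NS_sum (t : List ℕ) (s : Finset ℕ) : ∀ (b : ℕ) (F : ℕ → ℕ → ENNReal),
    NS t b (fun x => ∑ i ∈ s, F i x) = ∑ i ∈ s, NS t b (F i) := by
  induction t with
  | nil => intro b F; rfl
  | cons c t ih =>
    intro b F
    simp only [NS, ih, Finset.mul_sum]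
    rw [Finset.sum_comm]

lemma NS_append (t : List ℕ) (a : ℕ) (F : ℕ → ENNReal) : ∀ (b : ℕ),
    NS (t ++ [a]) b F = NS t b (fun x => ∑ m ∈ range x, wt a m * F m) := by
  induction t with
  | nil => intro b; rfl
  | cons c t ih =>
    intro b
    simp only [NS, ih, List.cons_append]

lemma NS_bound (t : List ℕ) (ht : ∀ k ∈ t, 1 ≤ k) (F : ℕ → ENNReal) (K : ENNReal) (B : ℕ)
    (hF : ∀ x ≤ B, F x ≤ K) : ∀ (b : ℕ), b ≤ B →
    NS t b F ≤ (∑ m ∈ range (B + 1), wt 1 m) ^ t.length * K := by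
  induction t with
  | nil => intro b hb; simpa [NS] using hF b hb
  | cons c t ih =>
    intro b hb
    have ih := ih (fun k hk => ht k (by simp [hk]))
    have hc := ht c (by simp)
    simp only [NS, List.length_cons]
    rw [pow_succ', mul_assoc, Finset.sum_mul]
    calc _ ≤ ∑ n ∈ range b, wt 1 n * ((∑ m ∈ range (B + 1), wt 1 m) ^ t.length * K) := by
          refine Finset.sum_le_sum fun n hn => ?_
          have hn := Finset.mem_range.1 hn
          refine mul_le_mul' ?_ (ih n (by omega))
          unfold wt
          split_ifs with h0
          · exact le_rfl
          · refine ENNReal.ofReal_le_ofReal ?_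
            have : (1 : ℝ) ≤ n := by exact_mod_cast Nat.one_le_iff_ne_zero.2 h0
            have := pow_le_pow_right₀ this hc
            gcongr
      _ ≤ _ := by
          refine Finset.sum_le_sum_of_subset ?_
          intro x hx
          simp at hx ⊢; omega

lemma wt_anti {c d : ℕ} (h : c ≤ d) (n : ℕ) : wt d n ≤ wt c n := by
  unfold wt
  split_ifs with h0
  · exact le_rfl
  · refine ENNReal.ofReal_le_ofReal ?_
    have : (1 : ℝ) ≤ n := by exact_mod_cast Nat.one_le_iff_ne_zero.2 h0
    have := pow_le_pow_right₀ this h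
    gcongr

/-- `1/(n-m) - 1/n` -/
noncomputable def dt (n m : ℕ) : ENNReal := ENNReal.ofReal (((n : ℝ) - m)⁻¹ - (n : ℝ)⁻¹)

lemma tsum_gt (p : ℕ) (g : ℕ → ENNReal) :
    ∑' n, (if p < n then g n else 0) = ∑' s, g (p + 1 + s) := by
  have hi : Function.Injective (fun s : ℕ => p + 1 + s) := add_right_injective _
  rw [← hi.tsum_eq (f := fun n => if p < n then g n else 0)]
  · refine tsum_congr fun s => ?_
    rw [if_pos (by omega)]
  · intro n hn
    have : p < n := by
      by_contra h
      simp [h] at hn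
    exact ⟨n - (p + 1), by simp; omega⟩

lemma tele (r : ℕ) (hr : 0 < r) :
    ∑' s : ℕ, ENNReal.ofReal (((r + s : ℕ) : ℝ)⁻¹ - ((r + s + 1 : ℕ) : ℝ)⁻¹)
      = ENNReal.ofReal ((r : ℝ)⁻¹) := by
  have h0 : ∀ s : ℕ, 0 ≤ ((r + s : ℕ) : ℝ)⁻¹ - ((r + s + 1 : ℕ) : ℝ)⁻¹ := by
    intro s
    have : (0 : ℝ) < ((r + s : ℕ) : ℝ) := by exact_mod_cast (by omega : 0 < r + s)
    rw [sub_nonneg]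
    exact inv_anti₀ this (by exact_mod_cast Nat.le_succ _)
  have hs : HasSum (fun s : ℕ => ((r + s : ℕ) : ℝ)⁻¹ - ((r + s + 1 : ℕ) : ℝ)⁻¹) ((r : ℝ)⁻¹) := by
    rw [hasSum_iff_tendsto_nat_of_nonneg h0]
    have e : ∀ n : ℕ, ∑ s ∈ range n, (((r + s : ℕ) : ℝ)⁻¹ - ((r + s + 1 : ℕ) : ℝ)⁻¹)
        = (r : ℝ)⁻¹ - ((r + n : ℕ) : ℝ)⁻¹ := by
      intro n
      have := Finset.sum_range_sub' (fun s : ℕ => ((r + s : ℕ) : ℝ)⁻¹) n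
      simpa [add_assoc] using this
    simp only [e]
    have h1 : Filter.Tendsto (fun n : ℕ => ((r + n : ℕ) : ℝ)⁻¹) Filter.atTop (nhds 0) := by
      refine tendsto_inv_atTop_zero.comp (tendsto_natCast_atTop_atTop.comp ?_)
      exact Filter.tendsto_atTop_mono (fun n => by simp) Filter.tendsto_id
    simpa using h1.const_sub ((r : ℝ)⁻¹)
  rw [← ENNReal.ofReal_tsum_of_nonneg h0 hs.summable, hs.tsum_eq]

lemma dt_sum (p m : ℕ) (h : m ≤ p) :
    ∑' n, (if p < n then dt n m else 0) = ∑ i ∈ range m, vt p i := by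
  induction m with
  | zero => simp [dt]
  | succ m ih =>
    rw [Finset.sum_range_succ, ← ih (by omega)]
    have h1 : vt p m = ∑' n, (if p < n then
        ENNReal.ofReal (((n : ℝ) - (m + 1 : ℕ))⁻¹ - ((n : ℝ) - m)⁻¹) else 0) := by
      rw [tsum_gt]
      have := tele (p - m) (by omega)
      rw [vt, ← Nat.cast_sub (by omega), ← this]
      refine tsum_congr fun s => ?_
      rw [← Nat.cast_sub (by omega), ← Nat.cast_sub (by omega)]
      congr 4 <;> omega
    rw [h1, ← ENNReal.tsum_add]
    refine tsum_congr fun n => ?_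
    split_ifs with hn
    · have a1 : (0 : ℝ) < (n : ℝ) - (m + 1 : ℕ) := by
        rw [sub_pos]; exact_mod_cast (by omega)
      have a2 : (n : ℝ) - (m + 1 : ℕ) ≤ n - m := by push_cast; linarith
      have a3 : (n : ℝ) - m ≤ n := by simp
      unfold dt
      rw [← ENNReal.ofReal_add]
      · congr 1; ring
      · rw [sub_nonneg]
        exact inv_anti₀ (a1.trans_le a2) a3
      · rw [sub_nonneg]
        exact inv_anti₀ a1 a2
    · simp

lemma pf_real (n m : ℝ) (hm : 0 < m) (hn : m < n) (s : ℕ) :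
    (n ^ (s + 1))⁻¹ * (n - m)⁻¹ + ∑ j ∈ range s, (n ^ (s + 1 - j))⁻¹ * (m ^ (j + 1))⁻¹
      = (m ^ (s + 1))⁻¹ * ((n - m)⁻¹ - n⁻¹) := by
  have h1 : n ≠ 0 := by linarith
  have h2 : n - m ≠ 0 := by linarith
  induction s with
  | zero => simp; field_simp; ring
  | succ s ih =>
    rw [Finset.sum_range_succ']
    have : ∑ j ∈ range s, (n ^ (s + 1 + 1 - (j + 1)))⁻¹ * (m ^ (j + 1 + 1))⁻¹
        = m⁻¹ * ∑ j ∈ range s, (n ^ (s + 1 - j))⁻¹ * (m ^ (j + 1))⁻¹ := by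
      rw [Finset.mul_sum]
      refine Finset.sum_congr rfl fun j _ => ?_
      rw [Nat.add_sub_add_right, pow_succ m (j + 1), mul_inv]; ring
    rw [this, eq_sub_of_add_eq' ih]
    simp only [Nat.sub_zero, pow_succ]
    field_simp
    ring

noncomputable def em (m : ℕ) : ENNReal := if m = 0 then 0 else 1

lemma pf_enn (n m s : ℕ) (hn : m < n) :
    em m * (wt (s + 1) n * vt n m) + ∑ j ∈ range s, wt (s + 1 - j) n * wt (j + 1) m
      = wt (s + 1) m * dt n m := by
  by_cases h0 : m = 0
  · simp [em, wt, h0]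
  have hm : (0 : ℝ) < m := by exact_mod_cast Nat.pos_of_ne_zero h0
  have hn' : (m : ℝ) < n := by exact_mod_cast hn
  have hp := pf_real n m hm hn' s
  have h2 : 0 < (n : ℝ) - m := by linarith
  have hn0 : n ≠ 0 := by omega
  simp only [em, wt, h0, if_false, hn0, one_mul, vt, dt]
  have e : ∀ j ∈ range s, ENNReal.ofReal (((n : ℝ) ^ (s + 1 - j))⁻¹) *
      ENNReal.ofReal (((m : ℝ) ^ (j + 1))⁻¹) =
      ENNReal.ofReal (((n : ℝ) ^ (s + 1 - j))⁻¹ * ((m : ℝ) ^ (j + 1))⁻¹) := fun j _ =>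
    (ENNReal.ofReal_mul (by positivity)).symm
  rw [Finset.sum_congr rfl e, ← ENNReal.ofReal_sum_of_nonneg (fun j _ => by positivity),
    ← ENNReal.ofReal_mul (by positivity), ← ENNReal.ofReal_mul (by positivity),
    ← ENNReal.ofReal_add (by positivity) (Finset.sum_nonneg fun j _ => by positivity), hp]

noncomputable def TEl : List ℕ → ENNReal
  | [] => 0
  | c :: t => TE c t

noncomputable def AE (a : ℕ) (t : List ℕ) : ENNReal :=
  ∑' n, NS t n (fun x => ∑ m ∈ range x, em m * (wt a n * vt n m))

lemma S1 (a : ℕ) (t : List ℕ) : TE a t = ZE (a + 1) t + AE a t := by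
  unfold TE ZE AE
  rw [← ENNReal.tsum_add]
  refine tsum_congr fun n => ?_
  by_cases h0 : n = 0
  · subst h0
    have : ∀ x, ∑ m ∈ range x, em m * (wt a 0 * vt 0 m) = 0 * 0 := by
      intro x; simp [wt]
    simp only [this]
    rw [NS_mul]
    simp [wt]
  rw [← NS_mul, ← NS_mul, ← NS_add]
  refine NS_congr _ _ _ _ fun x hx hx0 => ?_
  have hx0 := hx0 h0
  obtain ⟨y, rfl⟩ := Nat.exists_eq_succ_of_ne_zero hx0
  rw [Nat.succ_eq_add_one, Finset.sum_range_succ', Finset.sum_range_succ', mul_add, add_comm,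
    Finset.mul_sum]
  congr 1
  · simp only [wt, h0, if_false, vt, mul_one]
    rw [← ENNReal.ofReal_mul (by positivity)]
    congr 1
    simp [pow_succ, mul_comm]
  · simp [em]

lemma swap (f : ℕ → ℕ → ENNReal) :
    ∑' n, ∑ p ∈ range n, f n p = ∑' p, ∑' n, if p < n then f n p else 0 := by
  rw [ENNReal.tsum_comm]
  exact tsum_congr fun n => (tsum_lt n _).symm

lemma BE_eq (a : ℕ) (t : List ℕ) :
    ∑' n, NS t n (fun x => ∑ m ∈ range x, wt a m * dt n m) = TEl (t ++ [a]) := by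
  cases t with
  | nil =>
    simp only [NS, List.nil_append, TEl, TE]
    rw [swap]
    refine tsum_congr fun p => ?_
    rw [← dt_sum p p le_rfl, ← ENNReal.tsum_mul_left]
    exact tsum_congr fun n => by split_ifs <;> simp
  | cons c t =>
    simp only [NS, List.cons_append, TEl, TE]
    rw [swap]
    refine tsum_congr fun p => ?_
    rw [NS_append]
    have : ∀ n, (if p < n then wt c p * NS t p (fun x => ∑ m ∈ range x, wt a m * dt n m) else 0)
        = wt c p * NS t p (fun x => ∑ m ∈ range x, wt a m * if p < n then dt n m else 0) := by
      intro n
      split_ifs with h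
      · rfl
      · have := NS_mul t p 0 (fun _ => 0)
        simp only [zero_mul] at this
        simp [this]
    simp only [this]
    rw [ENNReal.tsum_mul_left, ← NS_tsum]
    congr 1
    refine NS_congr _ _ _ _ fun x hx _ => ?_
    rw [Summable.tsum_finsetSum (fun _ _ => ENNReal.summable)]
    refine Finset.sum_congr rfl fun m hm => ?_
    have := Finset.mem_range.1 hm
    rw [ENNReal.tsum_mul_left, dt_sum p m (by omega)]

lemma S2 (s : ℕ) (t : List ℕ) :
    AE (s + 1) t + ∑ j ∈ range s, ZE (s + 1 - j) (t ++ [j + 1]) = TEl (t ++ [s + 1]) := by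
  rw [← BE_eq]
  unfold AE ZE
  rw [← Summable.tsum_finsetSum (fun _ _ => ENNReal.summable), ← ENNReal.tsum_add]
  refine tsum_congr fun n => ?_
  simp only [NS_append, ← NS_mul]
  rw [← NS_sum, ← NS_add]
  refine NS_congr _ _ _ _ fun x hx _ => ?_
  simp only [Finset.mul_sum]
  rw [Finset.sum_comm, ← Finset.sum_add_distrib]
  refine Finset.sum_congr rfl fun m hm => ?_
  have := Finset.mem_range.1 hm
  rw [← pf_enn n m s (by omega)]
  simp

lemma fin_main (L : ℕ) : ∑' n, wt 2 n * (∑ m ∈ range (n + 1), wt 1 m) ^ L ≠ ⊤ := by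
  set ε : ℝ := 1 / ((L : ℝ) + 1) with hε
  have hε0 : 0 < ε := by positivity
  have hLε : L * ε < 1 := by
    rw [hε, mul_one_div, div_lt_one (by positivity)]; linarith
  have hsum : Summable (fun m : ℕ => (m : ℝ) ^ (-(1 + ε))) :=
    Real.summable_nat_rpow.2 (by linarith)
  set C := ∑' m : ℕ, (m : ℝ) ^ (-(1 + ε)) with hC
  have hC0 : 0 ≤ C := tsum_nonneg fun m => by positivity
  have hH : ∀ n : ℕ, n ≠ 0 → ∑ m ∈ range (n + 1), wt 1 m ≤ ENNReal.ofReal (C * (n : ℝ) ^ ε) := by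
    intro n hn
    have hterm : ∀ m ∈ range (n + 1), wt 1 m ≤
        ENNReal.ofReal ((m : ℝ) ^ (-(1 + ε)) * (n : ℝ) ^ ε) := by
      intro m hm
      have hm := Finset.mem_range.1 hm
      unfold wt
      split_ifs with h0
      · exact zero_le
      · refine ENNReal.ofReal_le_ofReal ?_
        have hm0 : (0 : ℝ) < m := by exact_mod_cast Nat.pos_of_ne_zero h0
        have hmn : (m : ℝ) ≤ n := by exact_mod_cast (by omega)
        calc ((m : ℝ) ^ 1)⁻¹ = (m : ℝ) ^ (-(1 + ε)) * (m : ℝ) ^ ε := by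
              rw [← Real.rpow_add hm0, pow_one, ← Real.rpow_neg_one]; congr 1; ring
          _ ≤ _ := by gcongr
    refine (Finset.sum_le_sum hterm).trans ?_
    rw [← ENNReal.ofReal_sum_of_nonneg (fun j _ => by positivity), ← Finset.sum_mul]
    refine ENNReal.ofReal_le_ofReal ?_
    gcongr
    exact hsum.sum_le_tsum _ (fun m _ => by positivity)
  have hs2 : Summable (fun n : ℕ => C ^ L * (n : ℝ) ^ (L * ε - 2)) :=
    (Real.summable_nat_rpow.2 (by linarith)).mul_left _
  refine ne_top_of_le_ne_top (hs2.tsum_ofReal_ne_top) (ENNReal.tsum_le_tsum fun n => ?_)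
  by_cases h0 : n = 0
  · simp [wt, h0]
  have hn0 : (0 : ℝ) < n := by exact_mod_cast Nat.pos_of_ne_zero h0
  calc _ ≤ wt 2 n * (ENNReal.ofReal (C * (n : ℝ) ^ ε)) ^ L := by gcongr; exact hH n h0
    _ = _ := by
      rw [wt, if_neg h0, ← ENNReal.ofReal_pow (by positivity), ← ENNReal.ofReal_mul (by positivity)]
      congr 1
      rw [mul_pow, ← Real.rpow_mul_natCast hn0.le, Real.rpow_sub hn0, mul_comm ε]
      norm_num
      ring

lemma ZE_fin (c : ℕ) (hc : 2 ≤ c) (t : List ℕ) (ht : ∀ k ∈ t, 1 ≤ k) : ZE c t ≠ ⊤ := by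
  refine ne_top_of_le_ne_top (fin_main t.length) (ENNReal.tsum_le_tsum fun n => ?_)
  refine mul_le_mul' (wt_anti hc n) ?_
  simpa using NS_bound t ht (fun _ => 1) 1 n (fun _ _ => le_rfl) n le_rfl

lemma vt_sum (n : ℕ) : ∑ m ∈ range n, vt n m = ∑ m ∈ range (n + 1), wt 1 m := by
  rw [Finset.sum_range_succ', ← Finset.sum_range_reflect]
  simp only [wt, if_true, add_zero]
  refine Finset.sum_congr rfl fun m hm => ?_
  have := Finset.mem_range.1 hm
  rw [vt, if_neg (by omega), ← Nat.cast_sub (by omega), pow_one]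
  congr 3
  omega

lemma TE_fin (c : ℕ) (hc : 2 ≤ c) (t : List ℕ) (ht : ∀ k ∈ t, 1 ≤ k) : TE c t ≠ ⊤ := by
  refine ne_top_of_le_ne_top (fin_main (t.length + 1)) (ENNReal.tsum_le_tsum fun n => ?_)
  refine mul_le_mul' (wt_anti hc n) ?_
  rw [pow_succ]
  refine NS_bound t ht _ _ n (fun x hx => ?_) n le_rfl
  rw [← vt_sum]
  refine Finset.sum_le_sum_of_subset ?_
  intro y hy
  simp at hy ⊢; omega

lemma ZEs_fin (s : ℕ) (t : List ℕ) (ht : ∀ k ∈ t, 1 ≤ k) :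
    ∀ j ∈ range s, ZE (s + 1 - j) (t ++ [j + 1]) ≠ ⊤ := by
  intro j hj
  have := Finset.mem_range.1 hj
  refine ZE_fin _ (by omega) _ ?_
  intro k hk
  rcases List.mem_append.1 hk with h | h
  · exact ht k h
  · simp at h; omega

lemma rot1 (a : ℕ) (t : List ℕ) (h : ∀ b ∈ a :: t, 1 ≤ b) (hT : TEl (a :: t) ≠ ⊤) :
    TEl (t ++ [a]) ≠ ⊤ := by
  obtain ⟨s, rfl⟩ : ∃ s, a = s + 1 := ⟨a - 1, by have := h a (by simp); omega⟩
  rw [← S2]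
  refine ENNReal.add_ne_top.2 ⟨?_, ?_⟩
  · refine ne_top_of_le_ne_top hT ?_
    rw [TEl, S1]
    exact le_add_self
  · exact ENNReal.sum_ne_top.2 (ZEs_fin s t fun k hk => h k (by simp [hk]))

lemma rot (u : List ℕ) : ∀ v : List ℕ, (∀ b ∈ u ++ v, 1 ≤ b) → TEl (u ++ v) ≠ ⊤ →
    TEl (v ++ u) ≠ ⊤ := by
  induction u with
  | nil => intro v _ h; simpa using h
  | cons x u ih =>
    intro v h hT
    have := rot1 x (u ++ v) h hT
    have := ih (v ++ [x]) (fun b hb => h b (by simp at hb ⊢; tauto)) (by simpa using this)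
    simpa using this

lemma TEl_fin (l : List ℕ) (h : ∀ b ∈ l, 1 ≤ b) (h2 : ∃ b ∈ l, 2 ≤ b) : TEl l ≠ ⊤ := by
  obtain ⟨b, hb, hb2⟩ := h2
  obtain ⟨s, u, rfl⟩ := List.append_of_mem hb
  refine rot (b :: u) s (fun k hk => h k (by simp at hk ⊢; tauto)) ?_
  exact TE_fin b hb2 (u ++ s) (fun k hk => h k (by simp at hk ⊢; tauto))

lemma Tval_TEl (l : List ℕ) (h : l ≠ []) : Tval l = (TEl l).toReal := by
  cases l with
  | nil => exact absurd rfl h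
  | cons c t => exact Tval_eq c t

end PF

theorem key_partial_fraction_relation (a : ℕ) (t : List ℕ)
    (hpos : ∀ b ∈ a :: t, 1 ≤ b) (h2 : ∃ b ∈ a :: t, 2 ≤ b) :
    Tval (a :: t) - Tval (t ++ [a]) =
      mzv ((a + 1) :: t) -
        ∑ j ∈ Finset.range (a - 1), mzv ((a - j) :: (t ++ [j + 1])) := by
  have hT1 := PF.TEl_fin _ hpos h2
  have hT2 := PF.rot1 a t hpos hT1
  rw [PF.Tval_TEl _ (by simp), PF.Tval_TEl _ (by simp)]
  simp only [PF.mzv_eq]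
  obtain ⟨s, rfl⟩ : ∃ s, a = s + 1 := ⟨a - 1, by have := hpos a (by simp); omega⟩
  have e2 := PF.S2 s t
  have e1 : PF.TEl ((s + 1) :: t) = _ := PF.S1 (s + 1) t
  rw [← e2] at hT2 ⊢
  rw [e1] at hT1 ⊢
  obtain ⟨z, A⟩ := ENNReal.add_ne_top.1 hT1
  obtain ⟨_, B⟩ := ENNReal.add_ne_top.1 hT2
  rw [ENNReal.toReal_add z A, ENNReal.toReal_add A B,
    ENNReal.toReal_sum (PF.ZEs_fin s t fun k hk => hpos k (by simp [hk]))]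
  simp only [Nat.add_sub_cancel]
  ring
end
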